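/- arXiv:0705.3270 — 2 statements merged into one kernel-verified Lean document; each statement's English description precedes it below -/
import Mathlib

section
/- Let (R_1,T_1) and (R_2,T_2) be two minimal AF-equivalence relations on Cantor sets X_1 and X_2, respectively, and for i = 1,2 let Y_i be a closed subset of X_i which is R_i-étale and R_i-thin. Assume (i) R_1 ≅ R_2, and (ii) there exists a homeomorphism α : Y_1 → Y_2 which implements an isomorphism between R_1|_{Y_1} and R_2|_{Y_2}. Then there exists a homeomorphism ᾱ : X_1 → X_2 which implements an isomorphism between R_1 and R_2 and which extends α, i.e. ᾱ|_{Y_1} = α. -/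
open Set Topology MeasureTheory

universe u v

/-! ### Basic notions: étale equivalence relations -/

/-- The set of composable pairs of an equivalence relation `R ⊆ X × X`. -/
def CompPairs {X : Type u} (R : Set (X × X)) : Set (↥R × ↥R) :=
  {q | (q.1 : X × X).2 = (q.2 : X × X).1}

/-- The topology on the set of composable pairs obtained from a topology `T` on `R`. -/
def compPairsTop {X : Type u} (R : Set (X × X)) (T : TopologicalSpace ↥R) :
    TopologicalSpace ↥(CompPairs R) :=
  letI := T; inferInstance

/-- The composition (product) map of the groupoid `R`. -/
def compMap {X : Type u} (R : Set (X × X))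
    (htrans : ∀ ⦃x y z : X⦄, (x, y) ∈ R → (y, z) ∈ R → (x, z) ∈ R) :
    ↥(CompPairs R) → ↥R := fun q =>
  ⟨((q.1.1 : X × X).1, (q.1.2 : X × X).2),
    htrans q.1.1.2 (by
      rw [show ((q.1.1 : X × X)).2 = ((q.1.2 : X × X)).1 from q.2]
      exact q.1.2.2)⟩

/-- The inverse map of the groupoid `R`. -/
def invMap {X : Type u} (R : Set (X × X))
    (hsymm : ∀ ⦃x y : X⦄, (x, y) ∈ R → (y, x) ∈ R) : ↥R → ↥R := fun p =>
  ⟨((p : X × X).2, (p : X × X).1), hsymm p.2⟩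

/-- `(R, T)` is an étale equivalence relation on `X`: a countable equivalence relation
equipped with a Hausdorff, locally compact, second countable topology `T` such that
composition of composable pairs is continuous, inversion is a homeomorphism, and the
range map `r(x,y) = x` is a local homeomorphism. -/
structure IsEtaleEquivRel {X : Type u} [TopologicalSpace X] (R : Set (X × X))
    (T : TopologicalSpace ↥R) : Prop where
  refl : ∀ x : X, (x, x) ∈ R
  symm : ∀ ⦃x y : X⦄, (x, y) ∈ R → (y, x) ∈ R
  trans : ∀ ⦃x y z : X⦄, (x, y) ∈ R → (y, z) ∈ R → (x, z) ∈ R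
  countable : ∀ x : X, {y | (x, y) ∈ R}.Countable
  t2 : @T2Space ↥R T
  locallyCompact : @LocallyCompactSpace ↥R T
  secondCountable : @SecondCountableTopology ↥R T
  continuous_comp : @Continuous _ _ (compPairsTop R T) T (compMap R trans)
  homeo_inv : @IsHomeomorph _ _ T T (invMap R symm)
  localHomeo_range : @IsLocalHomeomorph ↥R X T inferInstance fun p => (p : X × X).1

/-- A CEER: compact étale equivalence relation. -/
def IsCEER {X : Type u} [TopologicalSpace X] (R : Set (X × X))
    (T : TopologicalSpace ↥R) : Prop :=
  IsEtaleEquivRel R T ∧ @CompactSpace ↥R T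

/-- `R ⊆ X × X` is an equivalence relation. -/
def IsEquivRel {X : Type u} (R : Set (X × X)) : Prop :=
  (∀ x : X, (x, x) ∈ R) ∧ (∀ ⦃x y : X⦄, (x, y) ∈ R → (y, x) ∈ R) ∧
    (∀ ⦃x y z : X⦄, (x, y) ∈ R → (y, z) ∈ R → (x, z) ∈ R)

/-- The relative topology on `R ⊆ X × X` inherited from the product topology. -/
def relTop {X : Type u} [TopologicalSpace X] (R : Set (X × X)) : TopologicalSpace ↥R :=
  inferInstance

/-- Given a topology `T` on `R` and any `U ⊆ X × X` (intended: `U ⊆ R`), the relative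
topology on `U` induced from `(R, T)`. -/
def relSubTop {X : Type u} [TopologicalSpace X] {R : Set (X × X)}
    (T : TopologicalSpace ↥R) (U : Set (X × X)) : TopologicalSpace ↥U :=
  TopologicalSpace.induced Subtype.val
    (TopologicalSpace.coinduced (Subtype.val : ↥R → X × X) T)

/-- An equivalence relation is minimal if all equivalence classes are dense. -/
def IsMinimalRel {X : Type u} [TopologicalSpace X] (R : Set (X × X)) : Prop :=
  ∀ x : X, Dense {y | (x, y) ∈ R}

/-- `F` implements an isomorphism between the étale equivalence relations
`(R₁, T₁)` on `X` and `(R₂, T₂)` on `Z`. -/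
def ImplementsIso {X : Type u} {Z : Type v} [TopologicalSpace X] [TopologicalSpace Z]
    (R₁ : Set (X × X)) (T₁ : TopologicalSpace ↥R₁)
    (R₂ : Set (Z × Z)) (T₂ : TopologicalSpace ↥R₂) (F : X → Z) : Prop :=
  IsHomeomorph F ∧ (∀ x y : X, (x, y) ∈ R₁ ↔ (F x, F y) ∈ R₂) ∧
    ∃ G : ↥R₁ → ↥R₂, (∀ p : ↥R₁, (G p : Z × Z) = (F (p : X × X).1, F (p : X × X).2)) ∧
      @IsHomeomorph _ _ T₁ T₂ G

/-! ### Graphs, invariant measures, thin sets -/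

/-- A (local) graph in `(R, T)`: a clopen subset on which both the range and source maps
are homeomorphisms onto clopen subsets of `X`. -/
def IsGraph {X : Type u} [TopologicalSpace X] (R : Set (X × X))
    (T : TopologicalSpace ↥R) (U : Set ↥R) : Prop :=
  letI := T
  IsClopen U ∧
    IsClopen ((fun p : ↥R => (p : X × X).1) '' U) ∧
    IsClopen ((fun p : ↥R => (p : X × X).2) '' U) ∧
    Topology.IsEmbedding (fun p : ↥U => ((p : ↥R) : X × X).1) ∧
    Topology.IsEmbedding (fun p : ↥U => ((p : ↥R) : X × X).2)

/-- A probability measure is `R`-invariant when `μ(A) = μ(B)` for every graph `(A, γ, B)`. -/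
def IsInvariantMeasure {X : Type u} [TopologicalSpace X] [MeasurableSpace X]
    (R : Set (X × X)) (T : TopologicalSpace ↥R) (μ : Measure X) : Prop :=
  ∀ U : Set ↥R, IsGraph R T U →
    μ ((fun p : ↥R => (p : X × X).1) '' U) = μ ((fun p : ↥R => (p : X × X).2) '' U)

/-- `Y` is `R`-thin: `μ Y = 0` for every `R`-invariant probability measure `μ`. -/
def IsThin {X : Type u} [TopologicalSpace X] [MeasurableSpace X]
    (R : Set (X × X)) (T : TopologicalSpace ↥R) (Y : Set X) : Prop :=
  ∀ μ : Measure X, IsProbabilityMeasure μ → IsInvariantMeasure R T μ → μ Y = 0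

/-! ### AF-equivalence relations -/

/-- The inductive limit topology on `R = ⋃ n, Rseq n`, each `Rseq n` carrying its
relative topology from `X × X`. -/
def inductiveLimitTop {X : Type u} [TopologicalSpace X] (R : Set (X × X))
    (Rseq : ℕ → Set (X × X)) (hsub : ∀ n, Rseq n ⊆ R) : TopologicalSpace ↥R :=
  ⨆ n, TopologicalSpace.coinduced
    (fun p : ↥(Rseq n) => (⟨(p : X × X), hsub n p.2⟩ : ↥R)) (relTop (Rseq n))

/-- `(R, T)` is an AF-equivalence relation: the inductive limit of an ascending sequence
of CEERs `Δ_X = R₀ ⊆ R₁ ⊆ R₂ ⊆ ⋯` with each `Rₙ` open in `Rₙ₊₁`, `T` being the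
inductive limit topology. -/
def IsAFEquivRel {X : Type u} [TopologicalSpace X] (R : Set (X × X))
    (T : TopologicalSpace ↥R) : Prop :=
  ∃ (Rseq : ℕ → Set (X × X)) (hsub : ∀ n, Rseq n ⊆ R),
    Rseq 0 = Set.diagonal X ∧
    (∀ n, Rseq n ⊆ Rseq (n + 1)) ∧
    (∀ n, IsCEER (Rseq n) (relTop (Rseq n))) ∧
    (∀ n, IsOpen[relTop (Rseq (n + 1))]
      ((Subtype.val : ↥(Rseq (n + 1)) → X × X) ⁻¹' Rseq n)) ∧
    (⋃ n, Rseq n) = R ∧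
    T = inductiveLimitTop R Rseq hsub

/-! ### Clopen partitions and groupoid partitions -/

/-- `U · V` for subsets `U, V ⊆ X × X`. -/
def SetComp {X : Type u} (U V : Set (X × X)) : Set (X × X) :=
  {p | ∃ y : X, (p.1, y) ∈ U ∧ (y, p.2) ∈ V}

/-- `U⁻¹` for a subset `U ⊆ X × X`. -/
def SetInv {X : Type u} (U : Set (X × X)) : Set (X × X) :=
  {p | (p.2, p.1) ∈ U}

/-- `P` is finer than `Q` if every element of `P` is contained in some element of `Q`. -/
def FinerThan {α : Type u} (P Q : Set (Set α)) : Prop :=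
  ∀ U ∈ P, ∃ V ∈ Q, U ⊆ V

/-- A finite clopen partition of `(R, T)` by subsets of `X × X`. -/
def IsClopenPartitionRel {X : Type u} [TopologicalSpace X] (R : Set (X × X))
    (T : TopologicalSpace ↥R) (P : Set (Set (X × X))) : Prop :=
  letI := T
  P.Finite ∧ (∀ U ∈ P, U ⊆ R ∧ U.Nonempty ∧ IsClopen ((Subtype.val : ↥R → X × X) ⁻¹' U)) ∧
    P.PairwiseDisjoint id ∧ ⋃₀ P = R

/-- A finite clopen partition of a topological space `Z`. -/
def IsClopenPartitionSpace (Z : Type u) [TopologicalSpace Z] (P : Set (Set Z)) : Prop :=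
  P.Finite ∧ (∀ U ∈ P, U.Nonempty ∧ IsClopen U) ∧ P.PairwiseDisjoint id ∧ ⋃₀ P = Set.univ

/-- A groupoid partition of the CEER `(R, T)`. -/
def IsGroupoidPartition {X : Type u} [TopologicalSpace X] (R : Set (X × X))
    (T : TopologicalSpace ↥R) (P : Set (Set (X × X))) : Prop :=
  IsClopenPartitionRel R T P ∧
    (∀ U ∈ P, U ⊆ Set.diagonal X ∨ U ⊆ R \ Set.diagonal X) ∧
    (∀ U ∈ P,
      @Topology.IsEmbedding ↥U X (relSubTop T U) _ (fun p => (p : X × X).1) ∧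
      @Topology.IsEmbedding ↥U X (relSubTop T U) _ (fun p => (p : X × X).2)) ∧
    (∀ U ∈ P, U ⊆ R \ Set.diagonal X → (Prod.fst '' U) ∩ (Prod.snd '' U) = ∅) ∧
    (∀ U ∈ P, ∀ V ∈ P, SetComp U V = ∅ ∨ SetComp U V ∈ P) ∧
    (∀ U ∈ P, SetInv U ∈ P)

/-- The trace on the diagonal of a partition of `R`, viewed as a family of subsets of `X`. -/
def diagTrace {X : Type u} (P : Set (Set (X × X))) : Set (Set X) :=
  {A | ∃ U ∈ P, U ⊆ Set.diagonal X ∧ A = Prod.fst '' U}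

/-! ### Restriction to a closed subset -/

/-- The restriction `R|_Y` of `R ⊆ X × X` to `Y ⊆ X`, as a relation on `↥Y`. -/
def restrictRel {X : Type u} (R : Set (X × X)) (Y : Set X) : Set (↥Y × ↥Y) :=
  {p | ((p.1 : X), (p.2 : X)) ∈ R}

/-- The relative topology on `R|_Y` induced from `(R, T)`. -/
def restrictTop {X : Type u} [TopologicalSpace X] (R : Set (X × X))
    (T : TopologicalSpace ↥R) (Y : Set X) : TopologicalSpace ↥(restrictRel R Y) :=
  TopologicalSpace.induced
    (fun p : ↥(restrictRel R Y) => (⟨((p.1.1 : X), (p.1.2 : X)), p.2⟩ : ↥R)) T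

/-! ### Fibred products, transversality, joins -/

/-- The fibred product `R ×_X S`. -/
abbrev Fib {X : Type u} (R S : Set (X × X)) : Type u :=
  {q : ↥R × ↥S // (q.1 : X × X).2 = (q.2 : X × X).1}

/-- The range map `r((x,y),(y,z)) = x` on `R ×_X S`. -/
def fibR {X : Type u} {R S : Set (X × X)} (q : Fib R S) : X := (q.1.1 : X × X).1

/-- The source map `s((x,y),(y,z)) = z` on `R ×_X S`. -/
def fibS {X : Type u} {R S : Set (X × X)} (q : Fib R S) : X := (q.1.2 : X × X).2

/-- The relative topology on `R ×_X S` from the product of `(R, T)` and `(S, T')`. -/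
def fibTop {X : Type u} {R S : Set (X × X)} (T : TopologicalSpace ↥R)
    (T' : TopologicalSpace ↥S) : TopologicalSpace (Fib R S) :=
  letI := T; letI := T'; inferInstance

/-- `(R, T)` and `(S, T')` are transverse: `R ∩ S = Δ_X` and there is a homeomorphism
`h : R ×_X S → S ×_X R` with `r ∘ h = r` and `s ∘ h = s`. -/
def AreTransverse {X : Type u} [TopologicalSpace X] (R : Set (X × X))
    (T : TopologicalSpace ↥R) (S : Set (X × X)) (T' : TopologicalSpace ↥S) : Prop :=
  R ∩ S = Set.diagonal X ∧
    ∃ h : Fib R S → Fib S R,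
      @IsHomeomorph _ _ (fibTop T T') (fibTop T' T) h ∧
      (∀ q, fibR (h q) = fibR q) ∧ (∀ q, fibS (h q) = fibS q)

/-- The equivalence relation `R ∨ S` generated by `R` and `S`. -/
def joinRel {X : Type u} (R S : Set (X × X)) : Set (X × X) :=
  {p | Relation.EqvGen (fun a b => (a, b) ∈ R ∨ (a, b) ∈ S) p.1 p.2}

/-- The map `r × s : R ×_X S → R ∨ S`. -/
def rsFun {X : Type u} (R S : Set (X × X)) : Fib R S → ↥(joinRel R S) := fun q =>
  ⟨(fibR q, fibS q), by
    have h1 : ((q.1.1 : X × X).1, (q.1.1 : X × X).2) ∈ R := q.1.1.2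
    have h2 : ((q.1.1 : X × X).2, (q.1.2 : X × X).2) ∈ S := by
      rw [show ((q.1.1 : X × X)).2 = ((q.1.2 : X × X)).1 from q.2]
      exact q.1.2.2
    exact Relation.EqvGen.trans _ _ _ (Relation.EqvGen.rel _ _ (Or.inl h1))
      (Relation.EqvGen.rel _ _ (Or.inr h2))⟩

/-- The topology on `R ∨ S` transferred from `R ×_X S` via the bijection `r × s`. -/
def joinTop {X : Type u} [TopologicalSpace X] (R S : Set (X × X))
    (T : TopologicalSpace ↥R) (T' : TopologicalSpace ↥S) :
    TopologicalSpace ↥(joinRel R S) :=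
  TopologicalSpace.coinduced (rsFun R S) (fibTop T T')

/-- The topology on an image `f '' s` transferred from a topology on `s` via `f`. -/
def imageTop {α : Type u} {β : Type v} (s : Set α) (Ts : TopologicalSpace ↥s)
    (f : α → β) : TopologicalSpace ↥(f '' s) :=
  TopologicalSpace.coinduced (fun p : ↥s => ⟨f p.1, ⟨p.1, p.2, rfl⟩⟩) Ts
/-! ### Bratteli diagrams -/

/-- A (standard) Bratteli diagram. `V n` is the (finite, nonempty) vertex set at level `n`
(`V 0` a singleton), and `E n` is the edge set connecting level `n` to level `n + 1`
(so `E n` plays the role of `E_{n+1}` in the paper), with source map `src n : E n → V n`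
and range map `rng n : E n → V (n+1)`, both surjective. -/
structure BratteliDiagram : Type 1 where
  V : ℕ → Type
  E : ℕ → Type
  fin_V : ∀ n, Finite (V n)
  fin_E : ∀ n, Finite (E n)
  nonempty_V : ∀ n, Nonempty (V n)
  nonempty_E : ∀ n, Nonempty (E n)
  subsingleton_V0 : Subsingleton (V 0)
  src : ∀ n, E n → V n
  rng : ∀ n, E n → V (n + 1)
  src_surj : ∀ n, Function.Surjective (src n)
  rng_surj : ∀ n, Function.Surjective (rng n)

namespace BratteliDiagram

/-- The path space `X_{(V,E)}` of a Bratteli diagram. -/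
abbrev pathSpace (B : BratteliDiagram) : Type :=
  {x : ∀ n, B.E n // ∀ n, B.rng n (x n) = B.src (n + 1) (x (n + 1))}

/-- The topology on the path space: the relative topology from `∏ n, E n`
with each `E n` discrete. -/
def pathTop (B : BratteliDiagram) : TopologicalSpace B.pathSpace :=
  letI : ∀ n, TopologicalSpace (B.E n) := fun _ => ⊥
  inferInstance

/-- `AF_n(V,E)`: cofinality from level `n` on. -/
def AFn (B : BratteliDiagram) (n : ℕ) : Set (B.pathSpace × B.pathSpace) :=
  {p | ∀ m, n ≤ m → p.1.1 m = p.2.1 m}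

/-- The relative topology on `AF_n(V,E)` from `X_{(V,E)} × X_{(V,E)}`. -/
def AFnTop (B : BratteliDiagram) (n : ℕ) : TopologicalSpace ↥(B.AFn n) :=
  letI := B.pathTop
  inferInstance

/-- The cofinality relation `AF(V,E) = ⋃ n, AF_n(V,E)`. -/
def AF (B : BratteliDiagram) : Set (B.pathSpace × B.pathSpace) :=
  ⋃ n, B.AFn n

/-- The inductive limit topology on `AF(V,E)`. -/
def AFTop (B : BratteliDiagram) : TopologicalSpace ↥B.AF :=
  ⨆ n, TopologicalSpace.coinduced
    (fun p : ↥(B.AFn n) => (⟨p.1, Set.mem_iUnion.mpr ⟨n, p.2⟩⟩ : ↥B.AF)) (B.AFnTop n)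

/-- A Bratteli diagram is simple if for every level `n` there is a later level such that
every vertex at level `n` is connected by a path of edges to every vertex at that level. -/
def IsSimple (B : BratteliDiagram) : Prop :=
  ∀ n : ℕ, ∃ k : ℕ, ∀ (v : B.V n) (w : B.V (n + k + 1)),
    ∃ es : ∀ j, B.E j, B.src n (es n) = v ∧ B.rng (n + k) (es (n + k)) = w ∧
      ∀ j, n ≤ j → j + 1 ≤ n + k → B.rng j (es j) = B.src (j + 1) (es (j + 1))

end BratteliDiagram

/-- `Fs` determines an (edge) Bratteli subdiagram of `B`. -/
def IsSubdiagram (B : BratteliDiagram) (Fs : ∀ n, Set (B.E n)) : Prop :=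
  (∀ n, (Fs n).Nonempty) ∧ ∀ n, B.src (n + 1) '' Fs (n + 1) = B.rng n '' Fs n

/-- Vertex sets of the subdiagram determined by `Fs`. -/
def subVertex (B : BratteliDiagram) (Fs : ∀ n, Set (B.E n)) : ℕ → Type
  | 0 => B.V 0
  | n + 1 => ↥(B.rng n '' Fs n)

/-- The Bratteli subdiagram of `B` determined by `Fs`, as a Bratteli diagram. -/
def subdiagramB (B : BratteliDiagram) (Fs : ∀ n, Set (B.E n))
    (h : IsSubdiagram B Fs) : BratteliDiagram where
  V := subVertex B Fs
  E n := ↥(Fs n)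
  fin_V n := by
    cases n with
    | zero => exact B.fin_V 0
    | succ m => haveI := B.fin_V (m + 1); exact inferInstanceAs (Finite ↥(B.rng m '' Fs m))
  fin_E n := by haveI := B.fin_E n; exact inferInstanceAs (Finite ↥(Fs n))
  nonempty_V n := by
    cases n with
    | zero => exact B.nonempty_V 0
    | succ m =>
      obtain ⟨e, he⟩ := h.1 m
      exact ⟨⟨B.rng m e, ⟨e, he, rfl⟩⟩⟩
  nonempty_E n := by obtain ⟨e, he⟩ := h.1 n; exact ⟨⟨e, he⟩⟩
  subsingleton_V0 := B.subsingleton_V0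
  src n := match n with
    | 0 => fun e => B.src 0 e.1
    | m + 1 => fun e =>
      ⟨B.src (m + 1) e.1, by rw [← h.2 m]; exact ⟨e.1, e.2, rfl⟩⟩
  rng n := fun e => ⟨B.rng n e.1, ⟨e.1, e.2, rfl⟩⟩
  src_surj n := by
    cases n with
    | zero =>
      intro v
      haveI : Subsingleton (subVertex B Fs 0) := B.subsingleton_V0
      obtain ⟨e, he⟩ := h.1 0
      exact ⟨⟨e, he⟩, Subsingleton.elim _ _⟩
    | succ m =>
      intro v
      obtain ⟨vv, hvv⟩ := v
      rw [← h.2 m] at hvv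
      obtain ⟨e, he, hev⟩ := hvv
      exact ⟨⟨e, he⟩, Subtype.ext hev⟩
  rng_surj n := by
    intro v
    obtain ⟨vv, hv⟩ := v
    obtain ⟨e, he, hev⟩ := hv
    exact ⟨⟨e, he⟩, Subtype.ext hev⟩

/-! ### Orbit equivalence relation of a group action -/

/-- The orbit equivalence relation `R_G = {(x, g•x)}` of a group action. -/
def orbitRelSet (G : Type v) (X : Type u) [Group G] [MulAction G X] : Set (X × X) :=
  {p | ∃ g : G, p.2 = g • p.1}

/-- The topology on `R_G` transferred from the product topology on `X × G`
(`G` discrete) via the bijection `(x, g) ↦ (x, g • x)`. -/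
def orbitRelTop (G : Type v) (X : Type u) [TopologicalSpace X] [Group G] [MulAction G X] :
    TopologicalSpace ↥(orbitRelSet G X) :=
  letI : TopologicalSpace G := ⊥
  TopologicalSpace.coinduced
    (fun q : X × G => (⟨(q.1, q.2 • q.1), ⟨q.2, rfl⟩⟩ : ↥(orbitRelSet G X))) inferInstance

set_option linter.unusedSectionVars false

namespace Gluing

/-! ### Part 1: good relations and towers -/

section Basic

variable {X : Type*} [TopologicalSpace X]

/-- closed graph theorem for compact codomain -/
theorem cont_of_closed_graph {A B : Type*} [TopologicalSpace A] [TopologicalSpace B]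
    [CompactSpace B] (f : A → B) (h : IsClosed {p : A × B | f p.1 = p.2}) : Continuous f := by
  rw [continuous_iff_isClosed]
  intro C hC
  have h1 : IsClosed ({p : A × B | f p.1 = p.2} ∩ Prod.snd ⁻¹' C) :=
    h.inter (hC.preimage continuous_snd)
  have h2 := isClosedMap_fst_of_compactSpace _ h1
  convert h2 using 1
  ext a
  constructor
  · intro ha
    exact ⟨(a, f a), ⟨rfl, ha⟩, rfl⟩
  · rintro ⟨⟨a', b⟩, ⟨hb, hc⟩, rfl⟩
    simp only [mem_ofPred_eq] at hb
    simp only [mem_preimage] at hc ⊢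
    rw [hb]; exact hc

/-- projecting a closed set along a compact factor, swapped -/
theorem closed_proj {A B : Type*} [TopologicalSpace A] [TopologicalSpace B]
    [CompactSpace B] {P : A → B → Prop} (h : IsClosed {p : A × B | P p.1 p.2}) :
    IsClosed {a | ∃ b, P a b} := by
  have h2 := isClosedMap_fst_of_compactSpace _ h
  convert h2 using 1
  ext a
  constructor
  · rintro ⟨b, hb⟩
    exact ⟨(a, b), hb, rfl⟩
  · rintro ⟨⟨a', b⟩, hb, rfl⟩
    exact ⟨b, hb⟩

/-- Combine finitely many clopen sets into one labelling. -/
theorem exists_label {ι : Type*} [Finite ι] (C : ι → Set X) (hC : ∀ i, IsClopen (C i)) :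
    ∃ q : X → ℕ, Continuous q ∧ ∀ x y, q x = q y ↔ ∀ i, (x ∈ C i ↔ y ∈ C i) := by
  classical
  obtain ⟨N, ⟨en⟩⟩ := Finite.exists_equiv_fin ι
  refine ⟨fun x => Encodable.encode (fun j : Fin N => (C (en.symm j)).boolIndicator x), ?_, ?_⟩
  · have h1 : Continuous (fun x => (fun j : Fin N => (C (en.symm j)).boolIndicator x)) :=
      continuous_pi fun j => (continuous_boolIndicator_iff_isClopen _).2 (hC _)
    exact (continuous_of_discreteTopology (f := fun g : Fin N → Bool => Encodable.encode g)).comp h1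
  · intro x y
    constructor
    · intro h i
      have h2 := congrFun (Encodable.encode_injective h) (en i)
      simp only [Equiv.symm_apply_apply] at h2
      rw [Set.mem_iff_boolIndicator, Set.mem_iff_boolIndicator, h2]
    · intro h
      refine congrArg Encodable.encode (funext fun j => ?_)
      have := h (en.symm j)
      rw [Set.mem_iff_boolIndicator, Set.mem_iff_boolIndicator] at this
      exact Bool.eq_iff_iff.2 this

/-- joint refinement -/
theorem exists_pair (e f : X → ℕ) (he : Continuous e) (hf : Continuous f) :
    ∃ q : X → ℕ, Continuous q ∧ ∀ x y, q x = q y ↔ (e x = e y ∧ f x = f y) := by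
  refine ⟨fun x => Nat.pair (e x) (f x), ?_, ?_⟩
  · exact (continuous_of_discreteTopology (f := fun p : ℕ × ℕ => Nat.pair p.1 p.2)).comp
      (he.prodMk hf)
  · intro x y
    rw [Nat.pair_eq_pair]

theorem clopen_fiber {f : X → ℕ} (hf : Continuous f) (i : ℕ) : IsClopen {x | f x = i} :=
  (isClopen_discrete {i}).preimage hf

theorem range_bound [CompactSpace X] {f : X → ℕ} (hf : Continuous f) : ∃ N, ∀ x, f x < N := by
  have h := (isCompact_range hf).finite_of_discrete
  obtain ⟨N, hN⟩ := h.bddAbove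
  exact ⟨N + 1, fun x => Nat.lt_succ_of_le (hN ⟨x, rfl⟩)⟩

/-- Separate a closed set off the diagonal by a labelling. -/
theorem exists_sep [CompactSpace X] [T2Space X] [TotallyDisconnectedSpace X]
    (K : Set (X × X)) (hK : IsClosed K) (hd : ∀ x, (x, x) ∉ K) :
    ∃ q : X → ℕ, Continuous q ∧ ∀ x y, (x, y) ∈ K → q x ≠ q y := by
  have hKc : IsCompact K := hK.isCompact
  have key : ∀ p : K, ∃ C : Set X, IsClopen C ∧ p.1.1 ∈ C ∧ p.1.2 ∉ C := by
    rintro ⟨⟨x, y⟩, hp⟩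
    have hne : x ≠ y := by rintro rfl; exact hd _ hp
    obtain ⟨C, hC, h1, h2⟩ := exists_isClopen_of_totally_separated hne
    exact ⟨C, hC, h1, h2⟩
  choose C hC h1 h2 using key
  obtain ⟨t, ht⟩ := hKc.elim_finite_subcover (fun p : K => C p ×ˢ (C p)ᶜ)
    (fun p => (hC p).isOpen.prod (hC p).compl.isOpen)
    (fun p hp => mem_iUnion.2 ⟨⟨p, hp⟩, h1 _, h2 _⟩)
  obtain ⟨q, hq, hq2⟩ := exists_label (fun i : t => C i.1) (fun i => hC _)
  refine ⟨q, hq, ?_⟩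
  intro x y hxy heq
  have := ht hxy
  simp only [mem_iUnion] at this
  obtain ⟨p, hp, ha, hb⟩ := this
  exact hb (((hq2 x y).1 heq ⟨p, hp⟩).1 ha)

/-- Labelling of `X` that determines a locally constant function on the image of `W`. -/
theorem exists_sep_map [CompactSpace X] [T2Space X] [TotallyDisconnectedSpace X]
    {W : Type*} [TopologicalSpace W] [CompactSpace W] (c : W → X) (hc : Continuous c)
    (hinj : Function.Injective c) (φ : W → ℕ) (hφ : Continuous φ) :
    ∃ q : X → ℕ, Continuous q ∧ ∀ w w', q (c w) = q (c w') → φ w = φ w' := by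
  have hcl : IsClosed {p : W × W | φ p.1 ≠ φ p.2} := by
    have : IsClopen {p : W × W | φ p.1 ≠ φ p.2} :=
      (isClopen_discrete {p : ℕ × ℕ | p.1 ≠ p.2}).preimage
        ((hφ.comp continuous_fst).prodMk (hφ.comp continuous_snd))
    exact this.isClosed
  have hK : IsClosed (Prod.map c c '' {p : W × W | φ p.1 ≠ φ p.2}) :=
    (hcl.isCompact.image (hc.prodMap hc)).isClosed
  obtain ⟨q, hq, hq2⟩ := exists_sep _ hK (by
    rintro x ⟨⟨w, w'⟩, hw, hx⟩
    simp only [Prod.map, Prod.mk.injEq] at hx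
    exact hw (congrArg φ (hinj (hx.1.trans hx.2.symm))))
  refine ⟨q, hq, fun w w' h => ?_⟩
  by_contra hne
  exact hq2 _ _ ⟨(w, w'), hne, rfl⟩ h

/-- A compact étale equivalence relation, in combinatorial form. -/
structure GoodRel (S : X → X → Prop) : Prop where
  refl : ∀ x, S x x
  symm : ∀ {x y}, S x y → S y x
  trans : ∀ {x y z}, S x y → S y z → S x z
  closed : IsClosed {p : X × X | S p.1 p.2}
  openr : ∀ U : Set X, IsOpen U → IsOpen {x | ∃ y, S x y ∧ y ∈ U}
  diag : IsClosed {p : X × X | S p.1 p.2 ∧ p.1 ≠ p.2}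

/-- `f` labels the floors of a tower structure for `S`. -/
structure Tower (S : X → X → Prop) (f : X → ℕ) : Prop where
  inj : ∀ {x y}, S x y → f x = f y → x = y
  fib : ∀ {x x' y}, f x = f x' → S x y → ∃ y', S x' y' ∧ f y' = f y

theorem exists_pattern [CompactSpace X] {S : X → X → Prop} (hS : GoodRel S)
    (e : X → ℕ) (he : Continuous e) :
    ∃ q : X → ℕ, Continuous q ∧ ∀ x y, q x = q y ↔
      (∀ i, (∃ z, S x z ∧ e z = i) ↔ (∃ z, S y z ∧ e z = i)) := by
  obtain ⟨N, hN⟩ := range_bound he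
  obtain ⟨q, hq, hq2⟩ := exists_label (fun i : Fin N => {x | ∃ z, S x z ∧ e z = i}) (by
    intro i
    refine ⟨?_, hS.openr _ (clopen_fiber he i).isOpen⟩
    apply closed_proj
    exact hS.closed.inter ((clopen_fiber he i).isClosed.preimage continuous_snd))
  refine ⟨q, hq, fun x y => (hq2 x y).trans ?_⟩
  constructor
  · intro h i
    by_cases hi : i < N
    · exact h ⟨i, hi⟩
    · constructor
      · rintro ⟨z, -, hz⟩
        exact absurd (hz ▸ hN z) hi
      · rintro ⟨z, -, hz⟩
        exact absurd (hz ▸ hN z) hi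
  · intro h i
    exact h i

theorem tower_exists [CompactSpace X] [T2Space X] [TotallyDisconnectedSpace X]
    {S₁ S₂ : X → X → Prop} (h₁ : GoodRel S₁) (h₂ : GoodRel S₂)
    (h12 : ∀ x y, S₁ x y → S₂ x y) (e : X → ℕ) (he : Continuous e) :
    ∃ f : X → ℕ, Continuous f ∧ (∀ x y, f x = f y → e x = e y) ∧ Tower S₁ f ∧ Tower S₂ f := by
  obtain ⟨s, hs, hs2⟩ := exists_sep _ h₂.diag (by simp)
  obtain ⟨e0, he0, he02⟩ := exists_pair e s he hs
  obtain ⟨p1, hp1, hp12⟩ := exists_pattern h₁ e0 he0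
  obtain ⟨e1, he1, he12⟩ := exists_pair e0 p1 he0 hp1
  obtain ⟨p2, hp2, hp22⟩ := exists_pattern h₂ e1 he1
  obtain ⟨f, hf, hf2⟩ := exists_pair e1 p2 he1 hp2
  have inj : ∀ {x y}, S₂ x y → f x = f y → x = y := by
    intro x y hxy hfxy
    by_contra hne
    have h3 := ((he02 x y).1 ((he12 x y).1 ((hf2 x y).1 hfxy).1).1).2
    exact hs2 x y ⟨hxy, hne⟩ h3
  have inv1 : ∀ {x y}, S₁ x y → p1 x = p1 y := by
    intro x y hxy
    rw [hp12]
    intro i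
    constructor
    · rintro ⟨z, hz, hi⟩
      exact ⟨z, h₁.trans (h₁.symm hxy) hz, hi⟩
    · rintro ⟨z, hz, hi⟩
      exact ⟨z, h₁.trans hxy hz, hi⟩
  have inv2 : ∀ {x y}, S₂ x y → p2 x = p2 y := by
    intro x y hxy
    rw [hp22]
    intro i
    constructor
    · rintro ⟨z, hz, hi⟩
      exact ⟨z, h₂.trans (h₂.symm hxy) hz, hi⟩
    · rintro ⟨z, hz, hi⟩
      exact ⟨z, h₂.trans hxy hz, hi⟩
  refine ⟨f, hf, fun x y h => ((he02 x y).1 ((he12 x y).1 ((hf2 x y).1 h).1).1).1, ⟨?_, ?_⟩, ⟨inj, ?_⟩⟩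
  · intro x y hxy
    exact inj (h12 _ _ hxy)
  · intro x x' y hxx' hxy
    have ha := (hf2 _ _).1 hxx'
    have hb := (he12 _ _).1 ha.1
    obtain ⟨y', hy', hey⟩ := ((hp12 _ _).1 hb.2 (e0 y)).1 ⟨y, hxy, rfl⟩
    refine ⟨y', hy', (hf2 _ _).2 ⟨(he12 _ _).2 ⟨hey, ?_⟩, ?_⟩⟩
    · rw [← inv1 hy', ← hb.2, inv1 hxy]
    · rw [← inv2 (h12 _ _ hy'), ← ha.2, inv2 (h12 _ _ hxy)]
  · intro x x' y hxx' hxy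
    have ha := (hf2 _ _).1 hxx'
    obtain ⟨y', hy', hey⟩ := ((hp22 _ _).1 ha.2 (e1 y)).1 ⟨y, hxy, rfl⟩
    refine ⟨y', hy', (hf2 _ _).2 ⟨hey, ?_⟩⟩
    rw [← inv2 hy', ← ha.2, inv2 hxy]

end Basic

/-- Extending a partial injection of a finite set, preserving a colouring. -/
theorem exists_perm_extend {Q K W : Type*} [Finite Q] (κ : Q → K) (a b : W → Q)
    (hab : ∀ w w', a w = a w' ↔ b w = b w') (hκ : ∀ w, κ (a w) = κ (b w)) :
    ∃ σ : Equiv.Perm Q, (∀ q, κ (σ q) = κ q) ∧ ∀ w, σ (a w) = b w := by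
  classical
  have key : ∀ k : K, ∃ σ : Equiv.Perm {q // κ q = k}, ∀ w (h : κ (a w) = k),
      σ ⟨a w, h⟩ = ⟨b w, (hκ w) ▸ h⟩ := by
    intro k
    have := Fintype.ofFinite {q // κ q = k}
    -- choose representatives
    let A : Set {q // κ q = k} := {q | ∃ w, a w = q.1}
    choose rep hrep using fun q : A => q.2
    have hf : Function.Injective (fun q : A => q.1) := Subtype.val_injective
    have hkb : ∀ q : A, κ (b (rep q)) = k := fun q => by
      rw [← hκ, hrep]; exact q.1.2
    have hg : Function.Injective (fun q : A => (⟨b (rep q), hkb q⟩ : {q // κ q = k})) := by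
      intro q q' h
      have h1 : b (rep q) = b (rep q') := congrArg Subtype.val h
      have h2 := (hab _ _).2 h1
      rw [hrep, hrep] at h2
      exact Subtype.ext (Subtype.ext h2)
    let e0 : {x // x ∈ Set.range (fun q : A => q.1)} ≃
        {x // x ∈ Set.range (fun q : A => (⟨b (rep q), hkb q⟩ : {q // κ q = k}))} :=
      (Equiv.ofInjective _ hf).symm.trans (Equiv.ofInjective _ hg)
    refine ⟨e0.extendSubtype, ?_⟩
    intro w h
    have hmem : (⟨a w, h⟩ : {q // κ q = k}) ∈ A := ⟨w, rfl⟩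
    have hr : (⟨a w, h⟩ : {q // κ q = k}) ∈ Set.range (fun q : A => q.1) := ⟨⟨_, hmem⟩, rfl⟩
    rw [Equiv.extendSubtype_apply_of_mem e0 _ hr]
    have : (⟨⟨a w, h⟩, hr⟩ : {x // x ∈ Set.range (fun q : A => q.1)}) =
      Equiv.ofInjective _ hf ⟨_, hmem⟩ := rfl
    simp only [e0, Equiv.trans_apply]
    rw [this, Equiv.symm_apply_apply]
    apply Subtype.ext
    change b (rep ⟨_, hmem⟩) = b w
    rw [← hab, hrep]
  choose σ hσ using key
  refine ⟨(Equiv.sigmaFiberEquiv κ).symm.trans ((Equiv.sigmaCongrRight σ).trans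
    (Equiv.sigmaFiberEquiv κ)), ?_, ?_⟩
  · intro q
    exact (σ (κ q) ⟨q, rfl⟩).2
  · intro w
    change (σ (κ (a w)) ⟨a w, rfl⟩).1 = b w
    rw [hσ]

end Gluing

namespace Gluing

/-! ### Part 2: extension lemma -/

section Ext

variable {X : Type*} [TopologicalSpace X]
variable {W : Type*} [TopologicalSpace W]

/-- strong compatibility of the image of `a` with a tower structure -/
def Compat (a : W → X) (S : X → X → Prop) (f : X → ℕ) : Prop :=
  ∀ w w' x, S (a w) x → f x = f (a w') → x ∈ range a

/-- `a` and `c` see the same tower structure -/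
def Respects (a c : W → X) (S : X → X → Prop) (f : X → ℕ) : Prop :=
  (∀ w, f (a w) = f (c w)) ∧ ∀ w w', S (a w) (a w') ↔ S (c w) (c w')

theorem Respects.symm {a c : W → X} {S : X → X → Prop} {f : X → ℕ} (h : Respects a c S f) :
    Respects c a S f := ⟨fun w => (h.1 w).symm, fun w w' => (h.2 w w').symm⟩

theorem Compat.transfer {a c : W → X} {S : X → X → Prop} {f : X → ℕ} (hS : GoodRel S)
    (ht : Tower S f)
    (h : Respects a c S f) (hc : Compat a S f) : Compat c S f := by
  intro w w' x hx hf
  obtain ⟨x', hx', hfx'⟩ := ht.fib (h.1 w).symm hx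
  obtain ⟨w'', rfl⟩ := hc w w' x' hx' (by rw [hfx', hf, h.1])
  refine ⟨w'', ?_⟩
  have h1 := (h.2 w w'').1 hx'
  refine ht.inj (hS.trans (hS.symm h1) hx) ?_
  rw [← h.1, hfx']

theorem exists_extension [CompactSpace X] [T2Space X] [TotallyDisconnectedSpace X]
    [CompactSpace W] {S M : X → X → Prop} (hS : GoodRel S) (hM : GoodRel M)
    (hSM : ∀ x y, S x y → M x y) (f : X → ℕ) (hf : Continuous f) (ht : Tower S f)
    (c θ : W → X) (hc : Continuous c) (hθ : Continuous θ)
    (hci : Function.Injective c) (hθi : Function.Injective θ)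
    (hcθ : ∀ w, M (c w) (θ w)) (hr : Respects c θ S f) (hcomp : Compat c S f) :
    ∃ γ : X ≃ₜ X, (∀ x, M x (γ x)) ∧ (∀ x, f (γ x) = f x) ∧
      (∀ x x', S x x' ↔ S (γ x) (γ x')) ∧ ∀ w, γ (c w) = θ w := by
  classical
  have hcomp' : Compat θ S f := hcomp.transfer hS ht hr
  obtain ⟨g0, hg0, -, -, ht0⟩ := tower_exists hM hM (fun _ _ h => h) f hf
  obtain ⟨q1, hq1, hq12⟩ := exists_sep_map c hc hci (fun w => g0 (θ w)) (hg0.comp hθ)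
  obtain ⟨q2, hq2, hq22⟩ := exists_sep_map θ hθ hθi (fun w => g0 (c w)) (hg0.comp hc)
  obtain ⟨e1, he1, he12⟩ := exists_pair q1 q2 hq1 hq2
  obtain ⟨e2, he2, he22⟩ := exists_pair f g0 hf hg0
  obtain ⟨e3, he3, he32⟩ := exists_pair e1 e2 he1 he2
  obtain ⟨g, hg, hg2, htS, htM⟩ := tower_exists hS hM hSM e3 he3
  have gf : ∀ {x y}, g x = g y → f x = f y := fun h =>
    ((he22 _ _).1 ((he32 _ _).1 (hg2 _ _ h)).2).1
  have gg0 : ∀ {x y}, g x = g y → g0 x = g0 y := fun h =>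
    ((he22 _ _).1 ((he32 _ _).1 (hg2 _ _ h)).2).2
  have i1 : ∀ w w', g (c w) = g (c w') → g (θ w) = g (θ w') := by
    intro w w' h
    have h0 := hq12 w w' ((he12 _ _).1 ((he32 _ _).1 (hg2 _ _ h)).1).1
    obtain ⟨y, hy, hgy⟩ := htM.fib h (hcθ w)
    have : y = θ w' := ht0.inj (hM.trans (hM.symm hy) (hcθ w')) ((gg0 hgy).trans h0)
    rw [← hgy, this]
  have i2 : ∀ w w', g (θ w) = g (θ w') → g (c w) = g (c w') := by
    intro w w' h
    have h0 := hq22 w w' ((he12 _ _).1 ((he32 _ _).1 (hg2 _ _ h)).1).2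
    obtain ⟨y, hy, hgy⟩ := htM.fib h (hM.symm (hcθ w))
    have : y = c w' := ht0.inj (hM.trans (hM.symm hy) (hM.symm (hcθ w'))) ((gg0 hgy).trans h0)
    rw [← hgy, this]
  -- the quotient by the tower relation of `(S, g)`
  let st : Setoid X :=
    { r := fun x x' => ∃ y, S x y ∧ g y = g x'
      iseqv :=
        { refl := fun x => ⟨x, hS.refl x, rfl⟩
          symm := by
            rintro x x' ⟨y, hy, hg⟩
            obtain ⟨z, hz, hgz⟩ := htS.fib hg (hS.symm hy)
            exact ⟨z, hz, hgz⟩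
          trans := by
            rintro x x' x'' ⟨y, hy, hg⟩ ⟨z, hz, hg'⟩
            obtain ⟨t, ht, hgt⟩ := htS.fib hg.symm hz
            exact ⟨t, hS.trans hy ht, hgt.trans hg'⟩ } }
  let π : X → Quotient st := Quotient.mk st
  have hπ : ∀ {x x'}, π x = π x' ↔ ∃ y, S x y ∧ g y = g x' := by
    intro x x'
    exact Quotient.eq (r := st)
  have hπg : ∀ {x x'}, g x = g x' → π x = π x' := fun {x x'} h => hπ.2 ⟨x, hS.refl x, h⟩
  have hπS : ∀ {x x'}, S x x' → π x = π x' := fun {x x'} h => hπ.2 ⟨x', h, rfl⟩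
  have hfin : Finite (Quotient st) := by
    obtain ⟨N, hN⟩ := range_bound hg
    refine Finite.of_injective (β := Fin N) (fun q => ⟨g (Quotient.out q), hN _⟩) ?_
    intro q q' h
    have h1 : g (Quotient.out q) = g (Quotient.out q') := by simpa using h
    have h2 := hπg h1
    simpa [π] using h2
  let κ0 : X → Set ℕ × Set ℕ := fun x => ({i | ∃ y, S x y ∧ f y = i}, {i | ∃ y, M x y ∧ g y = i})
  have κS : ∀ {x y}, S x y → κ0 x = κ0 y := by
    intro x y h
    apply Prod.ext
    · ext i
      exact ⟨fun ⟨z, hz, hi⟩ => ⟨z, hS.trans (hS.symm h) hz, hi⟩,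
        fun ⟨z, hz, hi⟩ => ⟨z, hS.trans h hz, hi⟩⟩
    · ext i
      exact ⟨fun ⟨z, hz, hi⟩ => ⟨z, hM.trans (hM.symm (hSM _ _ h)) hz, hi⟩,
        fun ⟨z, hz, hi⟩ => ⟨z, hM.trans (hSM _ _ h) hz, hi⟩⟩
  have κf : ∀ {x y}, f x = f y → (κ0 x).1 = (κ0 y).1 := by
    intro x y h
    ext i
    constructor
    · rintro ⟨z, hz, rfl⟩
      obtain ⟨z', hz', hfz⟩ := ht.fib h hz
      exact ⟨z', hz', hfz⟩
    · rintro ⟨z, hz, rfl⟩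
      obtain ⟨z', hz', hfz⟩ := ht.fib h.symm hz
      exact ⟨z', hz', hfz⟩
  have κM : ∀ {x y}, M x y → (κ0 x).2 = (κ0 y).2 := by
    intro x y h
    ext i
    exact ⟨fun ⟨z, hz, hi⟩ => ⟨z, hM.trans (hM.symm h) hz, hi⟩,
        fun ⟨z, hz, hi⟩ => ⟨z, hM.trans h hz, hi⟩⟩
  have κg : ∀ {x y}, g x = g y → κ0 x = κ0 y := by
    intro x y h
    refine Prod.ext (κf (gf h)) ?_
    ext i
    constructor
    · rintro ⟨z, hz, rfl⟩
      obtain ⟨z', hz', hfz⟩ := htM.fib h hz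
      exact ⟨z', hz', hfz⟩
    · rintro ⟨z, hz, rfl⟩
      obtain ⟨z', hz', hfz⟩ := htM.fib h.symm hz
      exact ⟨z', hz', hfz⟩
  let κ : Quotient st → Set ℕ × Set ℕ := Quotient.lift κ0 (by
    rintro x x' ⟨y, hy, hg⟩
    exact (κS hy).trans (κg hg))
  have hκ : ∀ x, κ (π x) = κ0 x := fun x => rfl
  obtain ⟨σ, hσκ, hσ⟩ := exists_perm_extend κ (fun w => π (c w)) (fun w => π (θ w)) (by
    intro w w'
    rw [hπ, hπ]
    constructor
    · rintro ⟨y, hy, hgy⟩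
      obtain ⟨w'', rfl⟩ := hcomp w w' y hy (gf hgy)
      exact ⟨θ w'', (hr.2 _ _).1 hy, i1 _ _ hgy⟩
    · rintro ⟨y, hy, hgy⟩
      obtain ⟨w'', rfl⟩ := hcomp' w w' y hy (gf hgy)
      exact ⟨c w'', (hr.2 _ _).2 hy, i2 _ _ hgy⟩) (by
    intro w
    exact Prod.ext (κf (hr.1 w)) (κM (hcθ w)))
  -- same class and `M`-related implies `S`-related
  have toS : ∀ {y y'}, M y y' → π y = π y' → S y y' := by
    intro y y' h h'
    obtain ⟨z, hz, hgz⟩ := hπ.1 h'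
    have : z = y' := htM.inj (hM.trans (hM.symm (hSM _ _ hz)) h) hgz
    exact this ▸ hz
  have ex : ∀ (τ : Equiv.Perm (Quotient st)) (_ : ∀ q, κ (τ q) = κ q) (x : X),
      ∃ y, M x y ∧ π y = τ (π x) ∧ f y = f x := by
    intro τ hτ x
    obtain ⟨x1, hx1⟩ := Quotient.exists_rep (τ (π x))
    have hx1' : π x1 = τ (π x) := hx1
    have hk : κ0 x1 = κ0 x := by rw [← hκ, ← hκ, hx1', hτ]
    have hm : g x1 ∈ (κ0 x).2 := by rw [← hk]; exact ⟨x1, hM.refl _, rfl⟩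
    obtain ⟨x2, hx2, hgx2⟩ := hm
    have hk2 : κ0 x2 = κ0 x := (κg hgx2).trans hk
    have hm2 : f x ∈ (κ0 x2).1 := by rw [hk2]; exact ⟨x, hS.refl _, rfl⟩
    obtain ⟨y, hy, hfy⟩ := hm2
    refine ⟨y, hM.trans hx2 (hSM _ _ hy), ?_, hfy⟩
    rw [← hπS hy, hπg hgx2, hx1']
  have uniq : ∀ {y y'}, M y y' → π y = π y' → f y = f y' → y = y' := fun h h' h'' =>
    ht.inj (toS h h') h''
  choose γ hγM hγπ hγf using ex σ hσκ
  have hγi : Function.Injective γ := by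
    intro x x' h
    refine uniq (hM.trans (hγM x) (h ▸ hM.symm (hγM x'))) ?_ ?_
    · apply σ.injective
      rw [← hγπ, ← hγπ, h]
    · rw [← hγf x, ← hγf x', h]
  have huniq : ∀ x y, M x y → π y = σ (π x) → f y = f x → γ x = y := by
    intro x y h1 h2 h3
    exact uniq (hM.trans (hM.symm (hγM x)) h1) ((hγπ x).trans h2.symm) ((hγf x).trans h3.symm)
  have hγs : Function.Surjective γ := by
    intro y
    obtain ⟨x, hx1, hx2, hx3⟩ := ex σ.symm (by
      intro q
      rw [← hσκ, Equiv.apply_symm_apply]) y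
    refine ⟨x, huniq x y (hM.symm hx1) ?_ hx3.symm⟩
    rw [hx2, Equiv.apply_symm_apply]
  have hγc : Continuous γ := by
    apply cont_of_closed_graph
    have : {p : X × X | γ p.1 = p.2} = {p : X × X | M p.1 p.2} ∩
        {p : X × X | π p.2 = σ (π p.1) ∧ f p.2 = f p.1} := by
      ext ⟨x, y⟩
      constructor
      · rintro h
        have h' : γ x = y := h
        subst h'
        exact ⟨hγM x, hγπ x, hγf x⟩
      · rintro ⟨h1, h2, h3⟩
        exact huniq x y h1 h2 h3
    rw [this]
    refine hM.closed.inter ?_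
    let _ : TopologicalSpace (Quotient st) := ⊥
    have : DiscreteTopology (Quotient st) := ⟨rfl⟩
    have hπc : Continuous π := by
      refine continuous_def.2 fun U _ => ?_
      have : π ⁻¹' U = g ⁻¹' (g '' (π ⁻¹' U)) := by
        apply Subset.antisymm (subset_preimage_image _ _)
        rintro x ⟨x', hx', hgx⟩
        have := hπg hgx
        change π x ∈ U
        rw [← this]; exact hx'
      rw [this]
      exact (isOpen_discrete _).preimage hg
    have hσc : Continuous (fun q => σ q) := continuous_of_discreteTopology
    exact (isClosed_eq (hπc.comp continuous_snd) (hσc.comp (hπc.comp continuous_fst))).inter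
      (isClosed_eq (hf.comp continuous_snd) (hf.comp continuous_fst))
  let γe : X ≃ X := Equiv.ofBijective γ ⟨hγi, hγs⟩
  refine ⟨Continuous.homeoOfEquivCompactToT2 (f := γe) hγc, hγM, hγf, ?_, ?_⟩
  · intro x x'
    change S x x' ↔ S (γ x) (γ x')
    constructor
    · intro h
      refine toS (hM.trans (hM.symm (hγM x)) (hM.trans (hSM _ _ h) (hγM x'))) ?_
      rw [hγπ, hγπ, hπS h]
    · intro h
      refine toS (hM.trans (hγM x) (hM.trans (hSM _ _ h) (hM.symm (hγM x')))) ?_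
      apply σ.injective
      rw [← hγπ, ← hγπ, hπS h]
  · intro w
    exact huniq _ _ (hcθ w) (hσ w).symm (hr.1 w).symm

end Ext
end Gluing

namespace Gluing

/-! ### Part 3: the step lemma -/

section Step

variable {X : Type*} [TopologicalSpace X]
variable {W : Type*} [TopologicalSpace W]

theorem cont_of_factor {Z : Type*} [TopologicalSpace Z] {g : W → ℕ} (hg : Continuous g)
    (φ : W → Z) (h : ∀ w w', g w = g w' → φ w = φ w') : Continuous φ := by
  refine continuous_def.2 fun U _ => ?_
  have : φ ⁻¹' U = g ⁻¹' (g '' (φ ⁻¹' U)) := by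
    apply Subset.antisymm (subset_preimage_image _ _)
    rintro x ⟨x', hx', hgx⟩
    have := h _ _ hgx
    change φ x ∈ U
    rw [← this]; exact hx'
  rw [this]
  exact (isOpen_discrete _).preimage hg

/-- an increasing sequence of compact étale relations -/
structure Sys (R : ℕ → X → X → Prop) : Prop where
  good : ∀ n, GoodRel (R n)
  mono' : ∀ n x y, R n x y → R (n + 1) x y

theorem Sys.mono {R : ℕ → X → X → Prop} (h : Sys R) {m n : ℕ} (hmn : m ≤ n) {x y : X}
    (hxy : R m x y) : R n x y := by
  induction n, hmn using Nat.le_induction with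
  | base => exact hxy
  | succ n _ ih => exact h.mono' _ _ _ ih

def Full (R : ℕ → X → X → Prop) (γ : X ≃ₜ X) : Prop := ∃ n, ∀ x, R n x (γ x)

def IsoL (R : ℕ → X → X → Prop) (a c : W → X) : Prop :=
  ∀ n, ∃ m, ∀ w w', R n (a w) (a w') → R m (c w) (c w')

def Et (R : ℕ → X → X → Prop) (Y : Set X) : Prop :=
  ∀ n, IsClosed {p : X × X | R n p.1 p.2 ∧ p.1 ∈ Y ∧ p.2 ∉ Y}

def Small (R : ℕ → X → X → Prop) (c : W → X) : Prop :=
  ∀ A : Set X, IsClopen A → A.Nonempty → ∃ n, ∃ h : W → X, Continuous h ∧ Function.Injective h ∧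
    (∀ w, h w ∈ A) ∧ ∀ w, R n (c w) (h w)

/-- `γ` commutes with the tower structure -/
def Comm (S : X → X → Prop) (f : X → ℕ) (γ : X → X) : Prop :=
  (∀ x, f (γ x) = f x) ∧ ∀ x y, S x y ↔ S (γ x) (γ y)

theorem step_lemma [CompactSpace X] [T2Space X] [TotallyDisconnectedSpace X] [CompactSpace W]
    {R : ℕ → X → X → Prop} (hR : Sys R) (a c : W → X) (ha : Continuous a) (hc : Continuous c)
    (hai : Function.Injective a) (hci : Function.Injective c)
    (hiso : IsoL R a c) (het : Et R (range a)) (hsm : Small R c)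
    (k : ℕ) (f : X → ℕ) (hf : Continuous f) (ht : Tower (R k) f)
    (hr : Respects a c (R k) f) (hcomp : Compat a (R k) f)
    (n0 : ℕ) (e : X → ℕ) (he : Continuous e) :
    ∃ (n : ℕ) (f' : X → ℕ) (γ : X ≃ₜ X), n0 ≤ n ∧ k ≤ n ∧ Continuous f' ∧
      (∀ x y, f' x = f' y → f x = f y) ∧ (∀ x y, f' x = f' y → e x = e y) ∧
      Tower (R n) f' ∧ Tower (R k) f' ∧ Compat a (R n) f' ∧ Full R γ ∧ Comm (R k) f γ ∧
      Respects a (γ ∘ c) (R n) f' := by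
  classical
  obtain ⟨n, hn0, hnk⟩ : ∃ n, n0 ≤ n ∧ k ≤ n := ⟨max n0 k, le_max_left _ _, le_max_right _ _⟩
  have hG := hR.good n
  -- labels separating the image of `a` from the rest of its saturation
  have hcl : IsClosed {y | ∃ x, R n x y ∧ x ∈ range a ∧ y ∉ range a} := by
    apply closed_proj (P := fun y x => R n x y ∧ x ∈ range a ∧ y ∉ range a)
    exact (het n).preimage continuous_swap
  have hra : IsClosed (range a) := (isCompact_range ha).isClosed
  obtain ⟨s, hs, hs2⟩ := exists_sep
    ({y | ∃ x, R n x y ∧ x ∈ range a ∧ y ∉ range a} ×ˢ range a) (hcl.prod hra) (by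
      rintro x ⟨⟨y, -, -, h1⟩, h2⟩
      exact h1 h2)
  obtain ⟨e1, he1, he12⟩ := exists_pair f e hf he
  obtain ⟨e2, he2, he22⟩ := exists_pair e1 s he1 hs
  obtain ⟨f', hf', hf'2, htk, htn⟩ := tower_exists (hR.good k) hG
    (fun x y h => hR.mono hnk h) e2 he2
  have f'f : ∀ x y, f' x = f' y → f x = f y := fun x y h =>
    ((he12 _ _).1 ((he22 _ _).1 (hf'2 _ _ h)).1).1
  have f'e : ∀ x y, f' x = f' y → e x = e y := fun x y h =>
    ((he12 _ _).1 ((he22 _ _).1 (hf'2 _ _ h)).1).2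
  have f's : ∀ x y, f' x = f' y → s x = s y := fun x y h =>
    ((he22 _ _).1 (hf'2 _ _ h)).2
  have hcomp' : Compat a (R n) f' := by
    intro w w' x hx hfx
    by_contra hne
    exact hs2 x (a w') ⟨⟨a w, hx, ⟨w, rfl⟩, hne⟩, ⟨w', rfl⟩⟩ (f's _ _ hfx)
  -- base labels
  let P : W → Set ℕ := fun w => {l | ∃ w', R n (a w) (a w') ∧ f' (a w') = l}
  have hPne : ∀ w, (P w).Nonempty := fun w => ⟨_, w, hG.refl _, rfl⟩
  have hPR : ∀ w w', R n (a w) (a w') → P w = P w' := by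
    intro w w' h
    ext l
    exact ⟨fun ⟨v, hv, hl⟩ => ⟨v, hG.trans (hG.symm h) hv, hl⟩,
      fun ⟨v, hv, hl⟩ => ⟨v, hG.trans h hv, hl⟩⟩
  have hPf1 : ∀ w w', f' (a w) = f' (a w') → P w ⊆ P w' := by
    rintro w w' h l ⟨v, hv, hl⟩
    obtain ⟨y, hy, hfy⟩ := htn.fib h hv
    obtain ⟨v', rfl⟩ := hcomp' w' v y hy hfy
    exact ⟨v', hy, hfy.trans hl⟩
  have hPf : ∀ w w', f' (a w) = f' (a w') → P w = P w' := fun w w' h =>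
    Subset.antisymm (hPf1 _ _ h) (hPf1 _ _ h.symm)
  let lab : W → ℕ := fun w => sInf (P w)
  have hlab : ∀ w, ∃ v, R n (a w) (a v) ∧ f' (a v) = lab w := fun w => Nat.sInf_mem (hPne w)
  choose b hb1 hb2 using hlab
  have hlabR : ∀ w w', R n (a w) (a w') → lab w = lab w' := fun w w' h => by
    simp only [lab, hPR w w' h]
  have hlabc : Continuous lab :=
    cont_of_factor (hf'.comp ha) lab (fun w w' h => by simp only [lab, hPf w w' h])
  have hbu : ∀ w v, R n (a w) (a v) → f' (a v) = lab w → b w = v := by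
    intro w v h1 h2
    exact hai (htn.inj (hG.trans (hG.symm (hb1 w)) h1) ((hb2 w).trans h2.symm))
  have hbR : ∀ w w', R n (a w) (a w') → b w = b w' := by
    intro w w' h
    exact hbu w (b w') (hG.trans h (hb1 w')) ((hb2 w').trans (hlabR _ _ h).symm)
  have hbc : Continuous b := by
    apply cont_of_closed_graph
    have : {p : W × W | b p.1 = p.2} = {p : W × W | R n (a p.1) (a p.2)} ∩
        {p : W × W | f' (a p.2) = lab p.1} := by
      ext ⟨w, v⟩
      constructor
      · intro h
        have h' : b w = v := h
        subst h'
        exact ⟨hb1 w, hb2 w⟩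
      · rintro ⟨h1, h2⟩
        exact hbu w v h1 h2
    rw [this]
    exact (hG.closed.preimage (ha.prodMap ha)).inter
      (isClosed_eq ((hf'.comp ha).comp continuous_snd) (hlabc.comp continuous_fst))
  -- small embeddings
  have hex : ∀ l : ℕ, ∃ (i : ℕ) (h : W → X), Continuous h ∧ Function.Injective h ∧
      (∀ w, R i (c w) (h w)) ∧ ((∃ x, f' x = l) → ∀ w, f' (h w) = l) := by
    intro l
    by_cases hl : ∃ x, f' x = l
    · obtain ⟨i, h, h1, h2, h3, h4⟩ := hsm _ (clopen_fiber hf' l) hl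
      exact ⟨i, h, h1, h2, h4, fun _ => h3⟩
    · exact ⟨0, c, hc, hci, fun w => (hR.good 0).refl _, fun h => absurd h hl⟩
  choose ii hh hh1 hh2 hh3 hh4 using hex
  let H : W → X := fun w => hh (lab w) (b w)
  have hHc : Continuous H := by
    have h1 : Continuous (fun p : ℕ × W => hh p.1 p.2) := by
      rw [continuous_prod_of_discrete_left]
      intro l
      exact hh1 l
    exact h1.comp (hlabc.prodMk hbc)
  have hHf : ∀ w, f' (H w) = lab w := fun w => hh4 (lab w) ⟨_, hb2 w⟩ (b w)
  have hmate : ∀ w, ∃ y, R n (H w) y ∧ f' y = f' (a w) := by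
    intro w
    exact htn.fib (x := a (b w)) ((hb2 w).trans (hHf w).symm) (hG.symm (hb1 w))
  choose θ hθ1 hθ2 using hmate
  have hθc : Continuous θ := by
    apply cont_of_closed_graph
    have : {p : W × X | θ p.1 = p.2} = {p : W × X | R n (H p.1) p.2} ∩
        {p : W × X | f' p.2 = f' (a p.1)} := by
      ext ⟨w, v⟩
      constructor
      · intro h
        have h' : θ w = v := h
        subst h'
        exact ⟨hθ1 w, hθ2 w⟩
      · rintro ⟨h1, h2⟩
        exact htn.inj (hG.trans (hG.symm (hθ1 w)) h1) ((hθ2 w).trans h2.symm)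
    rw [this]
    exact (hG.closed.preimage (hHc.prodMap continuous_id)).inter
      (isClosed_eq (hf'.comp continuous_snd) ((hf'.comp ha).comp continuous_fst))
  have hθr : Respects a θ (R n) f' := by
    refine ⟨fun w => (hθ2 w).symm, fun w w' => ⟨fun h => ?_, fun h => ?_⟩⟩
    · have : H w = H w' := by simp only [H, hlabR _ _ h, hbR _ _ h]
      exact hG.trans (hG.symm (hθ1 w)) (this ▸ hθ1 w')
    · obtain ⟨x, hx, hfx⟩ := htn.fib (hθ2 w) h
      rw [hθ2] at hfx
      obtain ⟨w'', rfl⟩ := hcomp' w w' x hx hfx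
      have hl : lab w = lab w' := (hlabR _ _ hx).trans (by simp only [lab, hPf _ _ hfx])
      have hHH : H w = H w' := by
        refine htn.inj (hG.trans (hθ1 w) (hG.trans h (hG.symm (hθ1 w')))) ?_
        rw [hHf, hHf, hl]
      have hbb : b w = b w' := by
        apply hh2 (lab w)
        change H w = _
        rw [hHH, hl]
      have h1 := hb1 w
      rw [hbb] at h1
      exact hG.trans h1 (hG.symm (hb1 w'))
  have hθi : Function.Injective θ := by
    intro w w' h
    apply hai
    refine htn.inj ((hθr.2 _ _).2 (h ▸ hG.refl _)) ?_
    rw [← hθ2, ← hθ2, h]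
  -- bound
  obtain ⟨m1, hm1⟩ := hiso n
  obtain ⟨N, hN⟩ := range_bound hf'
  let m := max (max m1 n) (max k ((Finset.range N).sup ii))
  have hm : ∀ w, R m (c w) (θ w) := by
    intro w
    have g := hR.good m
    have h1 : R m (c w) (c (b w)) := hR.mono ((le_max_left _ _).trans (le_max_left _ _)) (hm1 _ _ (hb1 w))
    have h2 : R m (c (b w)) (H w) := by
      refine hR.mono ?_ (hh3 (lab w) (b w))
      refine le_trans ?_ ((le_max_right _ _).trans (le_max_right _ _))
      apply Finset.le_sup (f := ii)
      rw [Finset.mem_range, ← hb2 w]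
      exact hN _
    have h3 : R m (H w) (θ w) := hR.mono ((le_max_right _ _).trans (le_max_left _ _)) (hθ1 w)
    exact g.trans h1 (g.trans h2 h3)
  -- transfer of `R k`
  have hkr : Respects c θ (R k) f := by
    refine ⟨fun w => (hr.1 w).symm.trans (f'f _ _ (hθ2 w).symm), fun w w' => ?_⟩
    rw [← hr.2]
    constructor
    · intro h
      obtain ⟨y, hy, hfy⟩ := htk.fib (hθ2 w).symm h
      have h1 : R n (θ w) (θ w') := (hθr.2 _ _).1 (hR.mono hnk h)
      have : y = θ w' := htn.inj (hG.trans (hG.symm (hR.mono hnk hy)) h1) (hfy.trans (hθ2 w').symm)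
      exact this ▸ hy
    · intro h
      obtain ⟨y, hy, hfy⟩ := htk.fib (hθ2 w) h
      have h1 : R n (a w) (a w') := (hθr.2 _ _).2 (hR.mono hnk h)
      have : y = a w' := htn.inj (hG.trans (hG.symm (hR.mono hnk hy)) h1) (hfy.trans (hθ2 w'))
      exact this ▸ hy
  obtain ⟨γ, hγ1, hγ2, hγ3, hγ4⟩ := exists_extension (hR.good k) (hR.good m)
    (fun x y h => hR.mono ((le_max_left _ _).trans (le_max_right _ _)) h) f hf ht c θ hc hθc hci hθi hm hkr
    (hcomp.transfer (hR.good k) ht hr)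
  refine ⟨n, f', γ, hn0, hnk, hf', f'f, f'e, htn, htk, hcomp', ⟨m, hγ1⟩, ⟨hγ2, hγ3⟩, ?_⟩
  have : (γ ∘ c) = θ := funext hγ4
  rw [this]
  exact hθr

end Step
end Gluing

namespace Gluing

/-! ### Part 4: the back and forth construction -/

section Iterate

variable {X : Type*} [TopologicalSpace X]
variable {W : Type*} [TopologicalSpace W]

theorem Full.refl {R : ℕ → X → X → Prop} (hR : Sys R) : Full R (Homeomorph.refl X) :=
  ⟨0, fun x => (hR.good 0).refl x⟩

theorem Full.trans {R : ℕ → X → X → Prop} (hR : Sys R) {γ δ : X ≃ₜ X} (h : Full R γ)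
    (h' : Full R δ) : Full R (γ.trans δ) := by
  obtain ⟨n, hn⟩ := h
  obtain ⟨m, hm⟩ := h'
  exact ⟨max n m, fun x => (hR.good _).trans (hR.mono (le_max_left n m) (hn x))
    (hR.mono (le_max_right n m) (hm _))⟩

theorem Full.iff {R : ℕ → X → X → Prop} (hR : Sys R) {γ : X ≃ₜ X} (h : Full R γ) :
    ∃ k, ∀ n, k ≤ n → ∀ x y, R n x y ↔ R n (γ x) (γ y) := by
  obtain ⟨k, hk⟩ := h
  refine ⟨k, fun n hn x y => ?_⟩
  have hG := hR.good n
  have hx := hR.mono hn (hk x)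
  have hy := hR.mono hn (hk y)
  exact ⟨fun h => hG.trans (hG.symm hx) (hG.trans h hy),
    fun h => hG.trans hx (hG.trans h (hG.symm hy))⟩

theorem IsoL.full {R : ℕ → X → X → Prop} (hR : Sys R) {a c : W → X} (hi : IsoL R a c)
    {h g : X ≃ₜ X} (hh : Full R h) (hg : Full R g) : IsoL R (h ∘ a) (g ∘ c) := by
  obtain ⟨k, hk⟩ := hh.iff hR
  obtain ⟨l, hl⟩ := hg.iff hR
  intro n
  obtain ⟨m, hm⟩ := hi (max n k)
  refine ⟨max m l, fun w w' hw => ?_⟩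
  have h1 := (hk (max n k) (le_max_right _ _) _ _).2 (hR.mono (le_max_left n k) hw)
  exact (hl _ (le_max_right _ _) _ _).1 (hR.mono (le_max_left _ _) (hm _ _ h1))

theorem Et.full {R : ℕ → X → X → Prop} (hR : Sys R) {a : W → X} (hi : Et R (range a))
    {h : X ≃ₜ X} (hh : Full R h) : Et R (range (h ∘ a)) := by
  obtain ⟨k, hk⟩ := hh.iff hR
  intro n
  have h1 : Continuous fun p : X × X => (h.symm p.1, h.symm p.2) := by fun_prop
  have h2 := ((hR.good n).closed).inter ((hi (max n k)).preimage h1)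
  convert h2 using 1
  have hmem : ∀ x, x ∈ range (h ∘ a) ↔ h.symm x ∈ range a := by
    intro x
    constructor
    · rintro ⟨w, rfl⟩; exact ⟨w, by simp⟩
    · rintro ⟨w, hw⟩; exact ⟨w, by simp [hw]⟩
  ext ⟨x, y⟩
  simp only [mem_inter_iff, mem_ofPred_eq, mem_preimage, hmem]
  constructor
  · rintro ⟨h1, h2⟩
    refine ⟨h1, ?_, h2⟩
    rw [hk _ (le_max_right _ _)]
    simpa using hR.mono (le_max_left _ _) h1
  · rintro ⟨h1, -, h2⟩
    exact ⟨h1, h2⟩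

theorem Small.full {R : ℕ → X → X → Prop} (hR : Sys R) {a : W → X} (hi : Small R a)
    {h : X ≃ₜ X} (hh : Full R h) : Small R (h ∘ a) := by
  obtain ⟨k, hk⟩ := hh
  intro A hA hA'
  obtain ⟨n, φ, h1, h2, h3, h4⟩ := hi A hA hA'
  exact ⟨max k n, φ, h1, h2, h3, fun w => (hR.good _).trans
    ((hR.good _).symm (hR.mono (le_max_left _ _) (hk _))) (hR.mono (le_max_right _ _) (h4 w))⟩

theorem Comm.down {R : ℕ → X → X → Prop} (hR : Sys R) {k n : ℕ} (hkn : k ≤ n) {f : X → ℕ}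
    (hk : Tower (R k) f) (hn : Tower (R n) f) {η : X → X} (h : Comm (R n) f η) (x y : X) :
    R k x y ↔ R k (η x) (η y) := by
  have hG := hR.good n
  constructor
  · intro hxy
    obtain ⟨v, hv, hfv⟩ := hk.fib (h.1 x).symm hxy
    have := hn.inj (hG.trans (hG.symm (hR.mono hkn hv)) ((h.2 x y).1 (hR.mono hkn hxy)))
      (hfv.trans (h.1 y).symm)
    rwa [this] at hv
  · intro hxy
    obtain ⟨v, hv, hfv⟩ := hk.fib (h.1 x) hxy
    have := hn.inj (hG.trans (hG.symm (hR.mono hkn hv)) ((h.2 x y).2 (hR.mono hkn hxy)))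
      (hfv.trans (h.1 y))
    rwa [this] at hv

structure St (R : ℕ → X → X → Prop) (a c : W → X) (h g : X ≃ₜ X) (k : ℕ) (f : X → ℕ) :
    Prop where
  cont : Continuous f
  tower : Tower (R k) f
  fh : Full R h
  fg : Full R g
  compat : Compat (h ∘ a) (R k) f
  resp : Respects (h ∘ a) (g ∘ c) (R k) f

theorem St.swap {R : ℕ → X → X → Prop} (hR : Sys R) {a c : W → X} {h g : X ≃ₜ X} {k : ℕ}
    {f : X → ℕ} (hs : St R a c h g k f) : St R c a g h k f where
  cont := hs.cont
  tower := hs.tower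
  fh := hs.fg
  fg := hs.fh
  compat := Compat.transfer (hR.good k) hs.tower hs.resp hs.compat
  resp := hs.resp.symm

theorem half_step [CompactSpace X] [T2Space X] [TotallyDisconnectedSpace X] [CompactSpace W]
    {R : ℕ → X → X → Prop} (hR : Sys R) {a c : W → X} (ha : Continuous a) (hc : Continuous c)
    (hai : Function.Injective a) (hci : Function.Injective c)
    (hiso : IsoL R a c) (het : Et R (range a)) (hsm : Small R c)
    {h g : X ≃ₜ X} {k : ℕ} {f : X → ℕ} (hs : St R a c h g k f)
    (n0 : ℕ) (e : X → ℕ) (he : Continuous e) :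
    ∃ (n : ℕ) (f' : X → ℕ) (γ : X ≃ₜ X), n0 ≤ n ∧ k ≤ n ∧
      (∀ x y, f' x = f' y → f x = f y) ∧ (∀ x y, f' x = f' y → e x = e y) ∧
      Tower (R k) f' ∧ Comm (R k) f γ ∧ St R a c h (g.trans γ) n f' := by
  obtain ⟨n, f', γ, h1, h2, h3, h4, h5, h6, h7, h8, h9, h10, h11⟩ :=
    step_lemma hR (h ∘ a) (g ∘ c) (h.continuous.comp ha) (g.continuous.comp hc)
      (h.injective.comp hai) (g.injective.comp hci) (hiso.full hR hs.fh hs.fg)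
      (het.full hR hs.fh) (hsm.full hR hs.fg) k f hs.cont hs.tower hs.resp hs.compat n0 e he
  exact ⟨n, f', γ, h1, h2, h4, h5, h7, h10, ⟨h3, h6, hs.fh, hs.fg.trans hR h9, h8, h11⟩⟩

def Mate (S : X → X → Prop) (f f' : X → ℕ) : Prop :=
  ∀ u u' v v', f' u = f' v → S u u' → S v v' → f u' = f v' → f' u' = f' v'

theorem mate_of_tower {S : X → X → Prop} (hS : GoodRel S) {f f' : X → ℕ} (ht : Tower S f)
    (ht' : Tower S f') (hr : ∀ x y, f' x = f' y → f x = f y) : Mate S f f' := by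
  intro u u' v v' h1 h2 h3 h4
  obtain ⟨z, hz, hfz⟩ := ht'.fib h1 h2
  have := ht.inj (hS.trans (hS.symm hz) h3) ((hr _ _ hfz).trans h4)
  rw [← this, hfz]

/-- relation between consecutive states -/
structure Next (R : ℕ → X → X → Prop) (j : ℕ) (e : X → ℕ) (h : X ≃ₜ X) (k : ℕ)
    (f : X → ℕ) (h' : X ≃ₜ X) (k' : ℕ) (f' : X → ℕ) : Prop where
  lab : ∀ x, f (h' x) = f (h x)
  rel : ∀ x y, R k (h' x) (h' y) ↔ R k (h x) (h y)
  sep : ∀ x y, f' (h' x) = f' (h' y) → e x = e y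
  emb : ∀ x y, R j x y → R k' (h' x) (h' y)

theorem full_step [CompactSpace X] [T2Space X] [TotallyDisconnectedSpace X] [CompactSpace W]
    {R : ℕ → X → X → Prop} (hR : Sys R) {a c : W → X} (ha : Continuous a) (hc : Continuous c)
    (hai : Function.Injective a) (hci : Function.Injective c)
    (hiso : IsoL R a c) (hiso' : IsoL R c a) (het : Et R (range a)) (het' : Et R (range c))
    (hsm : Small R a) (hsm' : Small R c)
    (j : ℕ) (e : X → ℕ) (he : Continuous e)
    {h g : X ≃ₜ X} {k : ℕ} {f : X → ℕ} (hs : St R a c h g k f) :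
    ∃ (h' g' : X ≃ₜ X) (k' : ℕ) (f' : X → ℕ), St R a c h' g' k' f' ∧ k ≤ k' ∧
      (∀ x y, f' x = f' y → f x = f y) ∧ Mate (R k) f f' ∧
      Next R j e h k f h' k' f' ∧ Next R j e g k f g' k' f' := by
  obtain ⟨kh, hkh⟩ := hs.fh.iff hR
  obtain ⟨n, f1, γ, hn0, hkn, f1f, f1e, htk, hγ, hs1⟩ := half_step hR ha hc hai hci hiso het hsm'
    hs (max j kh) (e ∘ h.symm) (he.comp h.symm.continuous)
  obtain ⟨kg, hkg⟩ := hs1.fg.iff hR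
  obtain ⟨n', f2, η, hn0', hkn', f2f, f2e, htk', hη, hs2⟩ := half_step hR hc ha hci hai hiso' het'
    hsm (hs1.swap hR) (max j kg) (e ∘ (g.trans γ).symm) (he.comp (g.trans γ).symm.continuous)
  refine ⟨h.trans η, g.trans γ, n', f2, hs2.swap hR, hkn.trans hkn',
    fun x y hxy => f1f _ _ (f2f _ _ hxy), ?_, ⟨?_, ?_, ?_, ?_⟩, ⟨?_, ?_, ?_, ?_⟩⟩
  · intro u u' v v' h1 h2 h3 h4
    have h5 := mate_of_tower (hR.good k) hs.tower htk f1f u u' v v' (f2f _ _ h1) h2 h3 h4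
    exact mate_of_tower (hR.good n) hs1.tower htk' f2f u u' v v' h1 (hR.mono hkn h2)
      (hR.mono hkn h3) h5
  · intro x; exact f1f _ _ (hη.1 _)
  · intro x y; exact (hη.down hR hkn htk hs1.tower _ _).symm
  · intro x y hxy
    have h1 : f1 (h x) = f1 (h y) := by
      rw [← hη.1 (h x), ← hη.1 (h y)]; exact f2f _ _ hxy
    simpa using f1e _ _ h1
  · intro x y hxy
    have h1 := (hkh n ((le_max_right _ _).trans hn0) _ _).1
      (hR.mono ((le_max_left _ _).trans hn0) hxy)
    exact hR.mono hkn' ((hη.2 _ _).1 h1)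
  · intro x; exact hγ.1 _
  · intro x y; exact (hγ.2 _ _).symm
  · intro x y hxy
    simpa using f2e _ _ hxy
  · intro x y hxy
    exact (hkg n' ((le_max_right _ _).trans hn0') _ _).1
      (hR.mono ((le_max_left _ _).trans hn0') hxy)

structure Chain (R : ℕ → X → X → Prop) (e : ℕ → X → ℕ) (h g : ℕ → X ≃ₜ X) (k : ℕ → ℕ)
    (f : ℕ → X → ℕ) : Prop where
  cont : ∀ j, Continuous (f j)
  tower : ∀ j, Tower (R (k j)) (f j)
  fh : ∀ j, Full R (h j)
  fg : ∀ j, Full R (g j)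
  kmono : ∀ j, k j ≤ k (j + 1)
  ref : ∀ j x y, f (j + 1) x = f (j + 1) y → f j x = f j y
  mate : ∀ j, Mate (R (k j)) (f j) (f (j + 1))
  nh : ∀ j, Next R j (e j) (h j) (k j) (f j) (h (j + 1)) (k (j + 1)) (f (j + 1))
  ng : ∀ j, Next R j (e j) (g j) (k j) (f j) (g (j + 1)) (k (j + 1)) (f (j + 1))

variable {R : ℕ → X → X → Prop} {e : ℕ → X → ℕ} {h g : ℕ → X ≃ₜ X} {k : ℕ → ℕ}
    {f : ℕ → X → ℕ}

theorem Chain.swap (hC : Chain R e h g k f) : Chain R e g h k f where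
  cont := hC.cont
  tower := hC.tower
  fh := hC.fg
  fg := hC.fh
  kmono := hC.kmono
  ref := hC.ref
  mate := hC.mate
  nh := hC.ng
  ng := hC.nh

theorem Chain.ref_le (hC : Chain R e h g k f) {i j : ℕ} (hij : i ≤ j) {x y : X}
    (hxy : f j x = f j y) : f i x = f i y := by
  induction j, hij using Nat.le_induction with
  | base => exact hxy
  | succ n _ ih => exact ih (hC.ref _ _ _ hxy)

theorem Chain.down (hC : Chain R e h g k f) {j : ℕ} {x y : X}
    (hxy : f (j + 1) (h (j + 1) x) = f (j + 1) (g (j + 1) y)) : f j (h j x) = f j (g j y) := by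
  rw [← (hC.nh j).lab, ← (hC.ng j).lab]
  exact hC.ref _ _ _ hxy

theorem Chain.down_le (hC : Chain R e h g k f) {i j : ℕ} (hij : i ≤ j) {x y : X}
    (hxy : f j (h j x) = f j (g j y)) : f i (h i x) = f i (g i y) := by
  induction j, hij using Nat.le_induction with
  | base => exact hxy
  | succ n _ ih => exact ih (hC.down hxy)

theorem Chain.uniq (hC : Chain R e h g k f) (hsep : ∀ x y, (∀ j, e j x = e j y) → x = y)
    {x y y' : X} (h1 : ∀ j, f j (h j x) = f j (g j y)) (h2 : ∀ j, f j (h j x) = f j (g j y')) :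
    y = y' :=
  hsep _ _ fun j => (hC.ng j).sep _ _ ((h1 (j + 1)).symm.trans (h2 (j + 1)))

theorem Chain.exist [CompactSpace X] (hC : Chain R e h g k f) (x : X) :
    ∃ y, ∀ j, f j (h j x) = f j (g j y) := by
  have hcl : ∀ j, IsClosed {y | f j (h j x) = f j (g j y)} := fun j =>
    isClosed_eq continuous_const ((hC.cont j).comp (g j).continuous)
  obtain ⟨y, hy⟩ := IsCompact.nonempty_iInter_of_sequence_nonempty_isCompact_isClosed
    (fun j => {y | f j (h j x) = f j (g j y)}) (fun j y hy => hC.down hy)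
    (fun j => ⟨(g j).symm (h j x), by simp⟩) (hcl 0).isCompact hcl
  exact ⟨y, fun j => mem_iInter.1 hy j⟩

theorem Chain.pres (hR : Sys R) (hC : Chain R e h g k f)
    (hsep : ∀ x y, (∀ j, e j x = e j y) → x = y) {b : X → X}
    (hb : ∀ x j, f j (h j x) = f j (g j (b x))) (n : ℕ) :
    ∃ m, ∀ x y, R n x y → R m (b x) (b y) := by
  obtain ⟨l, hl⟩ := (hC.fg (n + 1)).iff hR
  refine ⟨max l (k (n + 1)), fun x x' hxx => ?_⟩
  have h0 := (hC.nh n).emb _ _ hxx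
  obtain ⟨w, hw, hfw⟩ := (hC.tower (n + 1)).fib (hb x (n + 1)) h0
  obtain ⟨y', rfl⟩ := (g (n + 1)).surjective w
  have key : ∀ J, n + 1 ≤ J → R (k J) (h J x) (h J x') ∧ R (k J) (g J (b x)) (g J y') ∧
      f J (h J x') = f J (g J y') := by
    intro J hJ
    induction J, hJ using Nat.le_induction with
    | base => exact ⟨h0, hw, hfw.symm⟩
    | succ J _ ih =>
      obtain ⟨h1, h2, h3⟩ := ih
      have h1' := ((hC.nh J).rel _ _).2 h1
      have h2' := ((hC.ng J).rel _ _).2 h2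
      rw [← (hC.nh J).lab, ← (hC.ng J).lab] at h3
      exact ⟨hR.mono (hC.kmono J) h1', hR.mono (hC.kmono J) h2',
        hC.mate J _ _ _ _ (hb x (J + 1)) h1' h2' h3⟩
  have hy : y' = b x' := by
    refine hC.uniq hsep (x := x') (fun j => ?_) (hb x')
    rcases le_total (n + 1) j with hj | hj
    · exact (key j hj).2.2
    · exact hC.down_le hj (key (n + 1) le_rfl).2.2
  rw [← hy, hl _ (le_max_left _ _)]
  exact hR.mono (le_max_right _ _) hw

theorem main_abstract [CompactSpace X] [T2Space X] [SecondCountableTopology X]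
    [TotallyDisconnectedSpace X] [CompactSpace W]
    (hR : Sys R) (hR0 : ∀ x y, R 0 x y → x = y) {a c : W → X}
    (ha : Continuous a) (hc : Continuous c)
    (hai : Function.Injective a) (hci : Function.Injective c)
    (hiso : IsoL R a c) (hiso' : IsoL R c a) (het : Et R (range a)) (het' : Et R (range c))
    (hsm : Small R a) (hsm' : Small R c) :
    ∃ b : X ≃ₜ X, (∀ w, b (a w) = c w) ∧ (∀ n, ∃ m, ∀ x y, R n x y → R m (b x) (b y)) ∧
      (∀ n, ∃ m, ∀ x y, R n x y → R m (b.symm x) (b.symm y)) := by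
  classical
  -- separating labels
  obtain ⟨e, he, hsep⟩ : ∃ e : ℕ → X → ℕ, (∀ j, Continuous (e j)) ∧
      ∀ x y, (∀ j, e j x = e j y) → x = y := by
    have hcount : Countable (TopologicalSpace.Clopens X) :=
      TopologicalSpace.Clopens.countable_iff_secondCountable.2 inferInstance
    obtain ⟨C, hC⟩ := exists_surjective_nat (TopologicalSpace.Clopens X)
    refine ⟨fun j x => if x ∈ (C j : Set X) then 1 else 0, fun j => ?_, fun x y hxy => ?_⟩
    · exact continuous_const.if (fun x hx => by
        rw [show {x | x ∈ (C j : Set X)} = (C j : Set X) from rfl,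
          (C j).isClopen.frontier_eq] at hx
        exact hx.elim) continuous_const
    · by_contra hne
      obtain ⟨U, hU, hxU, hyU⟩ := exists_isClopen_of_totally_separated hne
      obtain ⟨j, hj⟩ := hC ⟨U, hU⟩
      have := hxy j
      simp only [hj] at this
      have h1 : x ∈ U := hxU
      have h2 : y ∉ U := hyU
      simp [h1, h2] at this
  let σ := {p : (X ≃ₜ X) × (X ≃ₜ X) × ℕ × (X → ℕ) // St R a c p.1 p.2.1 p.2.2.1 p.2.2.2}
  have s0 : St R a c (Homeomorph.refl X) (Homeomorph.refl X) 0 (fun _ => 0) := by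
    refine ⟨continuous_const, ⟨fun h _ => hR0 _ _ h, fun {x x' y} _ _ => ⟨x',
      (hR.good 0).refl _, rfl⟩⟩, Full.refl hR, Full.refl hR, ?_, ?_⟩
    · intro w w' x hx _
      exact ⟨w, hR0 _ _ hx⟩
    · refine ⟨fun _ => rfl, fun w w' => ⟨fun h => ?_, fun h => ?_⟩⟩
      · have := hai (hR0 _ _ h)
        rw [this]; exact (hR.good 0).refl _
      · have := hci (hR0 _ _ h)
        rw [this]; exact (hR.good 0).refl _
  have hstep : ∀ (j : ℕ) (s : σ), ∃ t : σ, s.1.2.2.1 ≤ t.1.2.2.1 ∧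
      (∀ x y, t.1.2.2.2 x = t.1.2.2.2 y → s.1.2.2.2 x = s.1.2.2.2 y) ∧
      Mate (R s.1.2.2.1) s.1.2.2.2 t.1.2.2.2 ∧
      Next R j (e j) s.1.1 s.1.2.2.1 s.1.2.2.2 t.1.1 t.1.2.2.1 t.1.2.2.2 ∧
      Next R j (e j) s.1.2.1 s.1.2.2.1 s.1.2.2.2 t.1.2.1 t.1.2.2.1 t.1.2.2.2 := by
    rintro j ⟨⟨h, g, k, f⟩, hs⟩
    obtain ⟨h', g', k', f', h1, h2, h3, h4, h5, h6⟩ := full_step hR ha hc hai hci hiso hiso'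
      het het' hsm hsm' j (e j) (he j) hs
    exact ⟨⟨(h', g', k', f'), h1⟩, h2, h3, h4, h5, h6⟩
  choose nxt n1 n2 n3 n4 n5 using hstep
  let s : ℕ → σ := fun j => Nat.rec ⟨(Homeomorph.refl X, Homeomorph.refl X, 0, fun _ => 0), s0⟩
    (fun j t => nxt j t) j
  have hC : Chain R e (fun j => (s j).1.1) (fun j => (s j).1.2.1) (fun j => (s j).1.2.2.1)
      (fun j => (s j).1.2.2.2) :=
    ⟨fun j => (s j).2.cont, fun j => (s j).2.tower, fun j => (s j).2.fh, fun j => (s j).2.fg,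
      fun j => n1 j (s j), fun j => n2 j (s j), fun j => n3 j (s j), fun j => n4 j (s j),
      fun j => n5 j (s j)⟩
  choose b hb using hC.exist
  choose b' hb' using hC.swap.exist
  have hbb' : ∀ y, b (b' y) = y := fun y => hC.uniq hsep (hb (b' y)) (fun j => (hb' y j).symm)
  have hb'b : ∀ x, b' (b x) = x := fun y =>
    hC.swap.uniq hsep (hb' (b y)) (fun j => (hb y j).symm)
  have hbc : Continuous b := by
    apply cont_of_closed_graph
    have : {p : X × X | b p.1 = p.2} =
        ⋂ j, {p : X × X | (s j).1.2.2.2 ((s j).1.1 p.1) = (s j).1.2.2.2 ((s j).1.2.1 p.2)} := by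
      ext ⟨x, y⟩
      simp only [mem_ofPred_eq, mem_iInter]
      constructor
      · rintro rfl; exact hb x
      · intro h; exact hC.uniq hsep (hb x) h
    rw [this]
    exact isClosed_iInter fun j => isClosed_eq
      ((hC.cont j).comp (((s j).1.1).continuous.comp continuous_fst))
      ((hC.cont j).comp (((s j).1.2.1).continuous.comp continuous_snd))
  let E : X ≃ X := ⟨b, b', hb'b, hbb'⟩
  let b0 : X ≃ₜ X := Continuous.homeoOfEquivCompactToT2 (f := E) hbc
  refine ⟨b0, fun w => ?_, hC.pres hR hsep hb, hC.swap.pres hR hsep hb'⟩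
  exact hC.uniq hsep (hb (a w)) (fun j => (s j).2.resp.1 w)

end Iterate

end Gluing

namespace Gluing

/-! ### Part 5: thin sets are small -/

section Thin

variable {X : Type*} [TopologicalSpace X] [CompactSpace X] [T2Space X]
  [TotallyDisconnectedSpace X]

theorem class_finite {S : X → X → Prop} (hS : GoodRel S) (x : X) : {y | S x y}.Finite := by
  obtain ⟨f, hf, -, ht, -⟩ := tower_exists hS hS (fun _ _ h => h) (fun _ => 0) continuous_const
  obtain ⟨N, hN⟩ := range_bound hf
  refine Set.Finite.of_finite_image (f := f) ((Set.finite_lt_nat N).subset ?_) ?_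
  · rintro _ ⟨y, -, rfl⟩; exact hN y
  · intro y hy z hz h
    exact ht.inj (hS.trans (hS.symm hy) hz) h

theorem exists_inj (P Q : Set ℕ) (hP : P.Finite) (hQ : Q.Finite) (h : P.ncard ≤ Q.ncard) :
    ∃ i : ℕ → ℕ, MapsTo i P Q ∧ InjOn i P := by
  have h1 : P.encard ≤ Q.encard := by
    rw [← hP.cast_ncard_eq, ← hQ.cast_ncard_eq]; exact_mod_cast h
  obtain ⟨f, hf, hf2⟩ := hP.exists_injOn_of_encard_le h1
  exact ⟨f, fun x hx => hf hx, hf2⟩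

theorem small_case {S : X → X → Prop} (hS : GoodRel S) {Y N A : Set X}
    (hN : IsClopen N) (hA : IsClopen A) (hYN : Y ⊆ N)
    (hc : ∀ x, ({y | S x y} ∩ N).ncard ≤ ({y | S x y} ∩ A).ncard) :
    ∃ h : Y → X, Continuous h ∧ Function.Injective h ∧ (∀ w, h w ∈ A) ∧
      ∀ w : Y, S w (h w) := by
  classical
  obtain ⟨e, he, he2⟩ := exists_label (fun b : Bool => if b then N else A)
    (by intro i; cases i <;> simpa)
  have heN : ∀ x y, e x = e y → (x ∈ N ↔ y ∈ N) := fun x y h => by simpa using (he2 x y).1 h true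
  have heA : ∀ x y, e x = e y → (x ∈ A ↔ y ∈ A) := fun x y h => by simpa using (he2 x y).1 h false
  obtain ⟨f, hf, hfe, ht, -⟩ := tower_exists hS hS (fun _ _ h => h) e he
  let L : Set X → X → Set ℕ := fun B x => f '' ({y | S x y} ∩ B)
  have hLS : ∀ B x x', S x x' → L B x = L B x' := by
    intro B x x' h
    have : {y | S x y} = {y | S x' y} := by
      ext y; exact ⟨fun h' => hS.trans (hS.symm h) h', fun h' => hS.trans h h'⟩
    simp only [L, this]
  have hLf1 : ∀ B, (∀ x y, e x = e y → (x ∈ B ↔ y ∈ B)) → ∀ x x', f x = f x' →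
      L B x ⊆ L B x' := by
    rintro B hB x x' h l ⟨y, ⟨hy, hyB⟩, rfl⟩
    obtain ⟨y', hy', hfy⟩ := ht.fib h hy
    exact ⟨y', ⟨hy', (hB _ _ (hfe _ _ hfy)).2 hyB⟩, hfy⟩
  have hLf : ∀ B, (∀ x y, e x = e y → (x ∈ B ↔ y ∈ B)) → ∀ x x', f x = f x' →
      L B x = L B x' := fun B hB x x' h =>
    Subset.antisymm (hLf1 B hB _ _ h) (hLf1 B hB _ _ h.symm)
  have hinj : ∀ x, InjOn f {y | S x y} := fun x y hy z hz h =>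
    ht.inj (hS.trans (hS.symm hy) hz) h
  have hLfin : ∀ B x, (L B x).Finite := fun B x =>
    ((class_finite hS x).inter_of_left B).image f
  have hLc : ∀ B x, (L B x).ncard = ({y | S x y} ∩ B).ncard := fun B x =>
    ((hinj x).mono inter_subset_left).ncard_image
  have hex : ∀ P Q : Set ℕ, ∃ i : ℕ → ℕ, P.Finite → Q.Finite → P.ncard ≤ Q.ncard →
      MapsTo i P Q ∧ InjOn i P := by
    intro P Q
    by_cases h : P.Finite ∧ Q.Finite ∧ P.ncard ≤ Q.ncard
    · obtain ⟨i, hi⟩ := exists_inj P Q h.1 h.2.1 h.2.2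
      exact ⟨i, fun _ _ _ => hi⟩
    · exact ⟨id, fun h1 h2 h3 => (h ⟨h1, h2, h3⟩).elim⟩
  choose i hi using hex
  have hi' : ∀ x, MapsTo (i (L N x) (L A x)) (L N x) (L A x) ∧
      InjOn (i (L N x) (L A x)) (L N x) := fun x =>
    hi _ _ (hLfin _ _) (hLfin _ _) (by rw [hLc, hLc]; exact hc x)
  let φ : X → ℕ := fun x => i (L N x) (L A x) (f x)
  have hφ : Continuous φ := cont_of_factor hf φ (fun x x' h => by
    simp only [φ, hLf N heN _ _ h, hLf A heA _ _ h, h])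
  have hself : ∀ x ∈ N, f x ∈ L N x := fun x hx => ⟨x, ⟨hS.refl x, hx⟩, rfl⟩
  have hex2 : ∀ w : Y, ∃ y, S w y ∧ y ∈ A ∧ f y = φ w := by
    intro w
    obtain ⟨y, ⟨h1, h2⟩, h3⟩ := (hi' w).1 (hself w (hYN w.2))
    exact ⟨y, h1, h2, h3⟩
  choose h h1 h2 h3 using hex2
  refine ⟨h, ?_, ?_, h2, h1⟩
  · apply cont_of_closed_graph
    have : {p : Y × X | h p.1 = p.2} = {p | S p.1 p.2} ∩ {p | f p.2 = φ p.1} := by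
      ext ⟨w, y⟩
      simp only [mem_ofPred_eq, mem_inter_iff]
      constructor
      · rintro rfl; exact ⟨h1 w, h3 w⟩
      · rintro ⟨h4, h5⟩
        exact ht.inj (hS.trans (hS.symm (h1 w)) h4) ((h3 w).trans h5.symm)
    rw [this]
    refine IsClosed.inter ?_ ?_
    · exact hS.closed.preimage (f := fun p : Y × X => ((p.1 : X), p.2)) (by fun_prop)
    · exact isClosed_eq (hf.comp continuous_snd)
        (hφ.comp (continuous_subtype_val.comp continuous_fst))
  · intro w w' hw
    have hww : S (w : X) w' := hS.trans (h1 w) (by rw [hw]; exact hS.symm (h1 w'))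
    have h4 : φ w = φ w' := by rw [← h3, ← h3, hw]
    have h5 : f w = f w' := by
      simp only [φ, hLS _ _ _ hww] at h4
      exact (hi' w').2 (by rw [← hLS _ _ _ hww]; exact hself w (hYN w.2))
        (hself w' (hYN w'.2)) h4
    exact Subtype.ext (ht.inj hww h5)

theorem uniformOn_ncard [MeasurableSpace X] [BorelSpace X] {s : Set X} (hs : s.Finite)
    (t : Set X) : ProbabilityTheory.uniformOn s t = ((s ∩ t).ncard : ENNReal) / s.ncard := by
  rw [ProbabilityTheory.uniformOn, ProbabilityTheory.cond_apply hs.measurableSet,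
    Measure.count_apply_finite _ hs, Measure.count_apply_finite _ (hs.inter_of_left t),
    ENNReal.div_eq_inv_mul, ncard_eq_toFinset_card _ hs,
    ncard_eq_toFinset_card _ (hs.inter_of_left t)]

/-- invariance under the partial full group -/
def InvAbs [MeasurableSpace X] (R : ℕ → X → X → Prop) (μ : Measure X) : Prop :=
  ∀ (n : ℕ) (A B : Set X) (φ : X → X), IsClopen A → IsClopen B → BijOn φ A B →
    (∀ x ∈ A, R n x (φ x)) → μ A = μ B

theorem small_of_thin [SecondCountableTopology X] [MeasurableSpace X] [BorelSpace X]
    {R : ℕ → X → X → Prop} (hR : Sys R)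
    (hmin : ∀ A : Set X, IsClopen A → A.Nonempty → ∀ x, ∃ n, ∃ y ∈ A, R n x y)
    {Y : Set X} (hY : IsClosed Y)
    (hthin : ∀ μ : Measure X, IsProbabilityMeasure μ → InvAbs R μ → μ Y = 0) :
    Small R (Subtype.val : Y → X) := by
  classical
  intro A hA hAne
  by_contra hcon
  have : TopologicalSpace.MetrizableSpace X := TopologicalSpace.metrizableSpace_of_t3_secondCountable X
  let _ := TopologicalSpace.metrizableSpaceMetric X
  have key : ∀ (n : ℕ) (N : Set X), IsClopen N → Y ⊆ N →
      ∃ x, ({y | R n x y} ∩ A).ncard < ({y | R n x y} ∩ N).ncard := by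
    intro n N hN hYN
    by_contra! h
    exact hcon ⟨n, small_case (hR.good n) hN hA hYN h⟩
  -- a decreasing sequence of clopen neighbourhoods
  obtain ⟨N, hN, hYN, hNC⟩ : ∃ N : ℕ → Set X, (∀ n, IsClopen (N n)) ∧ (∀ n, Y ⊆ N n) ∧
      ∀ C, IsClopen C → Y ⊆ C → ∃ m, ∀ n, m ≤ n → N n ⊆ C := by
    have hcount : Countable (TopologicalSpace.Clopens X) :=
      TopologicalSpace.Clopens.countable_iff_secondCountable.2 inferInstance
    obtain ⟨C, hC⟩ := exists_surjective_nat (TopologicalSpace.Clopens X)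
    let D : ℕ → Set X := fun i => if Y ⊆ C i then C i else univ
    have hD : ∀ i, IsClopen (D i) := by
      intro i; simp only [D]; split_ifs
      · exact (C i).isClopen
      · exact isClopen_univ
    have hYD : ∀ i, Y ⊆ D i := by
      intro i; simp only [D]; split_ifs with h
      · exact h
      · exact subset_univ _
    refine ⟨fun n => ⋂ i ∈ Set.Iic n, D i, fun n => (Set.finite_Iic n).isClopen_biInter
      fun i _ => hD i, fun n => subset_iInter₂ fun i _ => hYD i, fun E hE hYE => ?_⟩
    obtain ⟨m, hm⟩ := hC ⟨E, hE⟩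
    refine ⟨m, fun n hn => ?_⟩
    have h1 : D m = E := by simp [D, hm, hYE]
    exact (biInter_subset_of_mem (show m ∈ Set.Iic n from hn)).trans h1.subset
  choose x hx using fun n => key n (N n) (hN n) (hYN n)
  let s : ℕ → Set X := fun n => {y | R n (x n) y}
  have hs : ∀ n, (s n).Finite := fun n => class_finite (hR.good n) _
  have hsne : ∀ n, (s n).Nonempty := fun n => ⟨x n, (hR.good n).refl _⟩
  let ν : ℕ → ProbabilityMeasure X := fun n => ⟨ProbabilityTheory.uniformOn (s n),
    ProbabilityTheory.isProbabilityMeasure_uniformOn (hs n) (hsne n)⟩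
  have hν : ∀ n (t : Set X), (ν n : Measure X) t = ((s n ∩ t).ncard : ENNReal) / (s n).ncard :=
    fun n t => uniformOn_ncard (hs n) t
  let U : Ultrafilter ℕ := Filter.hyperfilter ℕ
  obtain ⟨μ, -, hμ⟩ := isCompact_univ.ultrafilter_le_nhds (U.map ν) (by simp)
  have hlim : ∀ t : Set X, IsClopen t →
      Filter.Tendsto (fun n => (ν n : Measure X) t) U (𝓝 ((μ : Measure X) t)) := fun t ht =>
    ProbabilityMeasure.tendsto_measure_of_null_frontier_of_tendsto' hμ (by simp [ht])
  have hUev : ∀ m : ℕ, ∀ᶠ n in (U : Filter ℕ), m ≤ n := fun m =>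
    Nat.hyperfilter_le_atTop (Filter.eventually_ge_atTop m)
  have hinv : InvAbs R (μ : Measure X) := by
    intro n B C φ hB hC hφ hRφ
    refine tendsto_nhds_unique_of_eventuallyEq (hlim B hB) (hlim C hC) ?_
    filter_upwards [hUev n] with k hk
    have hG := hR.good k
    have hbij : BijOn φ (s k ∩ B) (s k ∩ C) := by
      refine ⟨fun y hy => ⟨hG.trans hy.1 (hR.mono hk (hRφ y hy.2)), hφ.mapsTo hy.2⟩,
        hφ.injOn.mono inter_subset_right, ?_⟩
      rintro z ⟨hz, hzC⟩
      obtain ⟨y, hy, rfl⟩ := hφ.surjOn hzC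
      exact ⟨y, ⟨hG.trans hz (hG.symm (hR.mono hk (hRφ y hy))), hy⟩, rfl⟩
    rw [hν, hν, ← hbij.image_eq, hbij.injOn.ncard_image]
  have hY0 := hthin μ inferInstance hinv
  -- lower bound for the mass of `A`
  obtain ⟨n, hn⟩ : ∃ n, ∀ x, ∃ y, R n x y ∧ y ∈ A := by
    obtain ⟨n, hn⟩ := isCompact_univ.elim_directed_cover
      (fun n => {x | ∃ y, R n x y ∧ y ∈ A}) (fun n => (hR.good n).openr A hA.isOpen)
      (by
        intro x _
        obtain ⟨n, y, hy, hxy⟩ := hmin A hA hAne x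
        exact mem_iUnion.2 ⟨n, y, hxy, hy⟩)
      (directed_of_isDirected_le (fun i j hij z ⟨y, hy, hyA⟩ => ⟨y, hR.mono hij hy, hyA⟩))
    exact ⟨n, fun x => hn (mem_univ x)⟩
  choose p hp hpA using hn
  obtain ⟨f, hf, -, ht, -⟩ := tower_exists (hR.good n) (hR.good n) (fun _ _ h => h)
    (fun _ => 0) continuous_const
  obtain ⟨M, hM⟩ := range_bound hf
  have hbound : ∀ k, n ≤ k → (s k).ncard ≤ M * (s k ∩ A).ncard := by
    intro k hk
    have h1 : (s k).ncard ≤ ((Set.Iio M) ×ˢ (s k ∩ A)).ncard := by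
      refine ncard_le_ncard_of_injOn (fun y => (f y, p y)) ?_ ?_
        ((Set.finite_Iio M).prod ((hs k).inter_of_left A))
      · intro y hy
        exact ⟨hM y, (hR.good k).trans hy (hR.mono hk (hp y)), hpA y⟩
      · intro y hy z hz hyz
        simp only [Prod.mk.injEq] at hyz
        exact ht.inj ((hR.good n).trans (hp y) (by rw [hyz.2]; exact (hR.good n).symm (hp z)))
          hyz.1
    rwa [ncard_prod, show (Set.Iio M).ncard = M by simp [Set.ncard_eq_toFinset_card']] at h1
  have hMA : (1 : ENNReal) / M ≤ (μ : Measure X) A := by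
    refine ge_of_tendsto (hlim A hA) ?_
    filter_upwards [hUev n] with k hk
    rw [hν]
    have hpos : 0 < (s k).ncard := (ncard_pos (hs k)).2 (hsne k)
    have hb := hbound k hk
    have hMpos : M ≠ 0 := by rintro rfl; simp at hb; omega
    rw [ENNReal.div_le_iff (by exact_mod_cast hMpos) (by simp), mul_comm, ← mul_div_assoc,
      ENNReal.le_div_iff_mul_le (Or.inl (by exact_mod_cast hpos.ne')) (Or.inl (by simp)), one_mul]
    exact_mod_cast hb
  have hApos : (μ : Measure X) Y < (μ : Measure X) A := by
    rw [hY0]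
    refine lt_of_lt_of_le ?_ hMA
    simp
  obtain ⟨O, hYO, hO, hOA⟩ := Set.exists_isOpen_lt_of_lt Y _ hApos
  obtain ⟨C, hC, hYC, hCO⟩ := exists_clopen_of_closed_subset_open hY hO hYO
  have hle : (μ : Measure X) A ≤ (μ : Measure X) C := by
    refine le_of_tendsto_of_tendsto (hlim A hA) (hlim C hC) ?_
    obtain ⟨m, hm⟩ := hNC C hC hYC
    filter_upwards [hUev m] with k hk
    rw [hν, hν]
    refine ENNReal.div_le_div_right (Nat.cast_le.2 ?_) _
    · exact (hx k).le.trans (ncard_le_ncard (inter_subset_inter_right _ (hm k hk))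
        ((hs k).inter_of_left C))
  exact absurd (hle.trans (measure_mono hCO)) (not_le.2 hOA)

end Thin

end Gluing

namespace Gluing

/-! ### Part 6: translation from étale relations -/

section Translate

theorem iso_symm {X : Type u} {Z : Type v} [TopologicalSpace X] [TopologicalSpace Z]
    {R₁ : Set (X × X)} {T₁ : TopologicalSpace ↥R₁}
    {R₂ : Set (Z × Z)} {T₂ : TopologicalSpace ↥R₂} {F : X → Z}
    (h : ImplementsIso R₁ T₁ R₂ T₂ F) :
    ImplementsIso R₂ T₂ R₁ T₁ h.1.homeomorph.symm := by
  obtain ⟨hF, hrel, G, hG, hGh⟩ := h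
  have hs : ∀ z, F (hF.homeomorph.symm z) = z := fun z => hF.homeomorph.apply_symm_apply z
  refine ⟨hF.homeomorph.symm.isHomeomorph, fun x y => by rw [hrel, hs, hs],
    (@IsHomeomorph.homeomorph _ _ T₁ T₂ G hGh).symm, ?_,
    @Homeomorph.isHomeomorph _ _ T₂ T₁ (@IsHomeomorph.homeomorph _ _ T₁ T₂ G hGh).symm⟩
  intro p
  obtain ⟨q, rfl⟩ := (@IsHomeomorph.homeomorph _ _ T₁ T₂ G hGh).surjective p
  rw [Homeomorph.symm_apply_apply]
  have h1 : ((@IsHomeomorph.homeomorph _ _ T₁ T₂ G hGh) q : Z × Z) = _ := hG q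
  rw [h1]
  have h2 : ∀ x, hF.homeomorph.symm (F x) = x := fun z => hF.homeomorph.symm_apply_apply z
  simp [h2]

theorem iso_trans {X : Type u} {Z : Type v} {V : Type*} [TopologicalSpace X] [TopologicalSpace Z]
    [TopologicalSpace V]
    {R₁ : Set (X × X)} {T₁ : TopologicalSpace ↥R₁}
    {R₂ : Set (Z × Z)} {T₂ : TopologicalSpace ↥R₂}
    {R₃ : Set (V × V)} {T₃ : TopologicalSpace ↥R₃} {F : X → Z} {F' : Z → V}
    (h : ImplementsIso R₁ T₁ R₂ T₂ F) (h' : ImplementsIso R₂ T₂ R₃ T₃ F') :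
    ImplementsIso R₁ T₁ R₃ T₃ (F' ∘ F) := by
  obtain ⟨hF, hrel, G, hG, hGh⟩ := h
  obtain ⟨hF', hrel', G', hG', hGh'⟩ := h'
  refine ⟨hF'.comp hF, fun x y => (hrel x y).trans (hrel' _ _), G' ∘ G, fun p => ?_,
    @IsHomeomorph.comp _ _ _ T₁ T₂ T₃ _ _ hGh' hGh⟩
  simp [hG', hG]

structure AFD {X : Type u} [TopologicalSpace X] (R : Set (X × X))
    (T : TopologicalSpace ↥R) (Rs : ℕ → Set (X × X)) : Prop where
  sub : ∀ n, Rs n ⊆ R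
  zero : Rs 0 = Set.diagonal X
  mono : ∀ n, Rs n ⊆ Rs (n + 1)
  ceer : ∀ n, IsCEER (Rs n) (relTop (Rs n))
  op : ∀ n, IsOpen[relTop (Rs (n + 1))] ((Subtype.val : ↥(Rs (n + 1)) → X × X) ⁻¹' Rs n)
  union : (⋃ n, Rs n) = R
  top : T = inductiveLimitTop R Rs sub

variable {X : Type u} [TopologicalSpace X] {R : Set (X × X)} {T : TopologicalSpace ↥R}
  {Rs : ℕ → Set (X × X)}

theorem afd_of (h : IsAFEquivRel R T) : ∃ Rs, AFD R T Rs := by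
  obtain ⟨Rs, h0, h1, h2, h3, h4, h5, h6⟩ := h
  exact ⟨Rs, h0, h1, h2, h3, h4, h5, h6⟩

theorem AFD.mono_le (h : AFD R T Rs) {m n : ℕ} (hmn : m ≤ n) : Rs m ⊆ Rs n :=
  monotone_nat_of_le_succ h.mono hmn

def AFD.incl (h : AFD R T Rs) (n : ℕ) : ↥(Rs n) → ↥R := fun p => ⟨p.1, h.sub n p.2⟩

theorem loc_inj {S : Set (X × X)} (hS : IsCEER S (relTop S)) {p : X × X} (hp : p ∈ S) :
    ∃ O : Set (X × X), IsOpen O ∧ p ∈ O ∧ ∀ q q', q ∈ S → q' ∈ S → q ∈ O → q' ∈ O →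
      q.1 = q'.1 → q = q' := by
  have h1 : IsLocalHomeomorph (fun p : S => (p : X × X).1) := hS.1.localHomeo_range
  obtain ⟨V, hV, hpV, hVi⟩ := h1.isLocallyInjective ⟨p, hp⟩
  obtain ⟨O, hO, rfl⟩ := isOpen_induced_iff.1 hV
  exact ⟨O, hO, hpV, fun q q' hq hq' hqO hqO' h =>
    congrArg Subtype.val (hVi (show (⟨q, hq⟩ : S) ∈ _ from hqO)
      (show (⟨q', hq'⟩ : S) ∈ _ from hqO') h)⟩

theorem good_of_ceer [T2Space X] {S : Set (X × X)} (hS : IsCEER S (relTop S)) :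
    GoodRel (fun x y => (x, y) ∈ S) := by
  have hcl : IsClosed S := (isCompact_iff_compactSpace.2 hS.2).isClosed
  have h1 : IsLocalHomeomorph (fun p : S => (p : X × X).1) := hS.1.localHomeo_range
  refine ⟨hS.1.refl, fun h => hS.1.symm h, fun h h' => hS.1.trans h h', hcl, ?_, ?_⟩
  · intro U hU
    have h2 := h1.isOpenMap ((Subtype.val : S → X × X) ⁻¹' (Prod.snd ⁻¹' U))
      ((hU.preimage continuous_snd).preimage continuous_subtype_val)
    convert h2 using 1
    ext x
    constructor
    · rintro ⟨y, hxy, hy⟩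
      exact ⟨⟨(x, y), hxy⟩, hy, rfl⟩
    · rintro ⟨⟨⟨x', y⟩, hxy⟩, hy, rfl⟩
      exact ⟨y, hxy, hy⟩
  · rw [← isOpen_compl_iff, isOpen_iff_forall_mem_open]
    intro p hp
    by_cases hpS : p ∈ S
    · have heq : p.1 = p.2 := by
        by_contra hne
        exact hp ⟨hpS, hne⟩
      obtain ⟨O, hO, hpO, hinj⟩ := loc_inj hS hpS
      have hc : Continuous fun q : X × X => (q.1, q.1) := by fun_prop
      refine ⟨O ∩ (fun q : X × X => (q.1, q.1)) ⁻¹' O, ?_, hO.inter (hO.preimage hc), hpO, ?_⟩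
      · rintro q ⟨hq1, hq2⟩ ⟨hqS, hne⟩
        have := hinj q (q.1, q.1) hqS (hS.1.refl _) hq1 hq2 rfl
        exact hne (congrArg Prod.snd this).symm
      · change (p.1, p.1) ∈ O
        have : (p.1, p.1) = p := Prod.ext rfl heq
        rw [this]; exact hpO
    · exact ⟨Sᶜ, fun q hq h => hq h.1, hcl.isOpen_compl, hpS⟩

theorem AFD.sys [T2Space X] (h : AFD R T Rs) : Sys (fun n x y => (x, y) ∈ Rs n) :=
  ⟨fun n => good_of_ceer (h.ceer n), fun n _ _ hxy => h.mono n hxy⟩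

theorem AFD.isOpen_iff (h : AFD R T Rs) (O : Set ↥R) :
    IsOpen[T] O ↔ ∀ n, IsOpen (h.incl n ⁻¹' O) := by
  have h2 : IsOpen[T] O ↔ IsOpen[inductiveLimitTop R Rs h.sub] O :=
    iff_of_eq (congrArg (fun t : TopologicalSpace ↥R => IsOpen[t] O) h.top)
  rw [h2, inductiveLimitTop, isOpen_iSup_iff]
  rfl

theorem AFD.cont_dom (h : AFD R T Rs) {Z : Type*} (TZ : TopologicalSpace Z) (φ : ↥R → Z)
    (hφ : ∀ n, Continuous (φ ∘ h.incl n)) : Continuous[T, TZ] φ := by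
  refine (@continuous_def _ _ T TZ φ).2 fun O hO => ?_
  rw [h.isOpen_iff]
  intro n
  exact hO.preimage (hφ n)

theorem AFD.cont_incl (h : AFD R T Rs) (n : ℕ) : Continuous[_, T] (h.incl n) := by
  refine (@continuous_def _ _ _ T _).2 fun O hO => ?_
  exact (h.isOpen_iff O).1 hO n

theorem AFD.rel_open (h : AFD R T Rs) {n m : ℕ} (hnm : n ≤ m) :
    ∃ O : Set (X × X), IsOpen O ∧ Rs n = O ∩ Rs m := by
  induction m, hnm using Nat.le_induction with
  | base => exact ⟨univ, isOpen_univ, by simp⟩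
  | succ m hm ih =>
    obtain ⟨O, hO, hn⟩ := ih
    obtain ⟨O', hO', h2⟩ := isOpen_induced_iff.1 (h.op m)
    refine ⟨O ∩ O', hO.inter hO', ?_⟩
    have h3 : Rs m = O' ∩ Rs (m + 1) := by
      have := congrArg (fun s => Subtype.val '' s) h2
      simp only [Subtype.image_preimage_coe] at this
      rw [inter_comm O', this, inter_eq_right.2 (h.mono m)]
    rw [hn, inter_assoc, ← h3]

theorem AFD.open_val (h : AFD R T Rs) (n : ℕ) {O : Set (X × X)} (hO : IsOpen O) :
    IsOpen[T] {p : ↥R | (p : X × X) ∈ Rs n ∩ O} := by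
  rw [h.isOpen_iff]
  intro m
  have h1 : ∃ O' : Set (X × X), IsOpen O' ∧ ∀ p ∈ Rs m, (p ∈ Rs n ↔ p ∈ O') := by
    rcases le_total n m with hnm | hmn
    · obtain ⟨O', hO', hn⟩ := h.rel_open hnm
      exact ⟨O', hO', fun p hp => by rw [hn]; exact ⟨fun q => q.1, fun q => ⟨q, hp⟩⟩⟩
    · exact ⟨univ, isOpen_univ, fun p hp => ⟨fun _ => trivial, fun _ => h.mono_le hmn hp⟩⟩
  obtain ⟨O', hO', hn⟩ := h1
  have h2 : h.incl m ⁻¹' {p : ↥R | (p : X × X) ∈ Rs n ∩ O} = Subtype.val ⁻¹' (O' ∩ O) := by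
    ext ⟨p, hp⟩
    have := hn p hp
    change (p ∈ Rs n ∧ p ∈ O) ↔ (p ∈ O' ∧ p ∈ O)
    rw [this]
  rw [h2]
  exact (hO'.inter hO).preimage continuous_subtype_val

theorem AFD.cpt_bound (h : AFD R T Rs) {K : Type*} [TopologicalSpace K] [CompactSpace K]
    (φ : K → ↥R) (hφ : Continuous[_, T] φ) : ∃ n, ∀ x, (φ x : X × X) ∈ Rs n := by
  obtain ⟨n, hn⟩ := isCompact_univ.elim_directed_cover
    (fun n => φ ⁻¹' {p : ↥R | (p : X × X) ∈ Rs n ∩ univ})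
    (fun n => (@continuous_def _ _ _ T φ).1 hφ _ (h.open_val n isOpen_univ))
    (by
      intro x _
      have h1 : (φ x : X × X) ∈ ⋃ n, Rs n := by rw [h.union]; exact (φ x).2
      obtain ⟨n, hn⟩ := mem_iUnion.1 h1
      exact mem_iUnion.2 ⟨n, hn, trivial⟩)
    (directed_of_isDirected_le (fun i j hij z hz => ⟨h.mono_le hij hz.1, trivial⟩))
  exact ⟨n, fun x => (hn (mem_univ x)).1⟩

theorem AFD.compact (h : AFD R T Rs) (n : ℕ) : CompactSpace ↥(Rs n) := (h.ceer n).2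

section Two

variable {Z : Type v} [TopologicalSpace Z] {R' : Set (Z × Z)} {T' : TopologicalSpace ↥R'}
  {Rs' : ℕ → Set (Z × Z)}

theorem iso_bound (h : AFD R T Rs) (h' : AFD R' T' Rs') {F : X → Z}
    (hF : ImplementsIso R T R' T' F) (n : ℕ) :
    ∃ m, ∀ x y, (x, y) ∈ Rs n → (F x, F y) ∈ Rs' m := by
  obtain ⟨-, -, G, hG, hGh⟩ := hF
  haveI := h.compact n
  have hc : Continuous[T, T'] G := @IsHomeomorph.continuous _ _ T T' G hGh
  obtain ⟨m, hm⟩ := h'.cpt_bound (G ∘ h.incl n)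
    (@Continuous.comp _ _ _ _ T T' _ _ hc (h.cont_incl n))
  refine ⟨m, fun x y hxy => ?_⟩
  have := hm ⟨(x, y), hxy⟩
  simp only [Function.comp, hG] at this
  exact this

theorem iso_bound_restrict (h : AFD R T Rs) (h' : AFD R' T' Rs') {Y : Set X} {Y' : Set Z}
    (hY : IsCompact Y) (hcl : ∀ n, IsClosed (Rs n))
    {F : Y → Y'} (hF : ImplementsIso (restrictRel R Y) (restrictTop R T Y)
      (restrictRel R' Y') (restrictTop R' T' Y') F) (n : ℕ) :
    ∃ m, ∀ x y : Y, ((x : X), (y : X)) ∈ Rs n → ((F x : Z), (F y : Z)) ∈ Rs' m := by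
  obtain ⟨-, -, G, hG, hGh⟩ := hF
  have hc : Continuous[restrictTop R T Y, restrictTop R' T' Y'] G :=
    @IsHomeomorph.continuous _ _ (restrictTop R T Y) (restrictTop R' T' Y') G hGh
  haveI : CompactSpace Y := isCompact_iff_compactSpace.1 hY
  let K := {p : Y × Y // ((p.1 : X), (p.2 : X)) ∈ Rs n}
  haveI : CompactSpace K := by
    refine isCompact_iff_compactSpace.1 (IsClosed.isCompact ?_)
    exact (hcl n).preimage (f := fun p : Y × Y => ((p.1 : X), (p.2 : X))) (by fun_prop)
  let ψ : K → ↥(restrictRel R Y) := fun p => ⟨p.1, h.sub n p.2⟩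
  have hψ : Continuous[_, restrictTop R T Y] ψ := by
    refine continuous_induced_rng.2 ?_
    let χ : K → ↥(Rs n) := fun p => ⟨((p.1.1 : X), (p.1.2 : X)), p.2⟩
    have hχ : Continuous χ := by
      refine Continuous.subtype_mk ?_ _
      fun_prop
    have h5 : Continuous[_, T] (h.incl n ∘ χ) :=
      @Continuous.comp _ _ _ _ _ T χ (h.incl n) (h.cont_incl n) hχ
    exact h5
  let θ : ↥(restrictRel R' Y') → ↥R' := fun p => ⟨((p.1.1 : Z), (p.1.2 : Z)), p.2⟩
  have hθ : Continuous[restrictTop R' T' Y', T'] θ := continuous_induced_dom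
  obtain ⟨m, hm⟩ := h'.cpt_bound (θ ∘ G ∘ ψ)
    (@Continuous.comp _ _ _ _ (restrictTop R' T' Y') T' _ _ hθ
      (@Continuous.comp _ _ _ _ (restrictTop R T Y) (restrictTop R' T' Y') _ _ hc hψ))
  refine ⟨m, fun x y hxy => ?_⟩
  have h1 := hm ⟨(x, y), hxy⟩
  have h2 := hG ⟨(x, y), h.sub n hxy⟩
  have h3 : ((θ ∘ G ∘ ψ) ⟨(x, y), hxy⟩ : Z × Z) = ((F x : Z), (F y : Z)) := by
    change (((G ⟨(x, y), h.sub n hxy⟩ : Y' × Y').1 : Z), ((G ⟨(x, y), h.sub n hxy⟩ : Y' × Y').2 : Z)) = _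
    rw [h2]
  rwa [h3] at h1

end Two

theorem implements_of (h : AFD R T Rs) (b : X ≃ₜ X)
    (h1 : ∀ n, ∃ m, ∀ x y, (x, y) ∈ Rs n → (b x, b y) ∈ Rs m)
    (h2 : ∀ n, ∃ m, ∀ x y, (x, y) ∈ Rs n → (b.symm x, b.symm y) ∈ Rs m) :
    ImplementsIso R T R T b := by
  have key : ∀ d : X ≃ₜ X, (∀ n, ∃ m, ∀ x y, (x, y) ∈ Rs n → (d x, d y) ∈ Rs m) →
      ∃ hd : ∀ x y, (x, y) ∈ R → (d x, d y) ∈ R,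
        Continuous[T, T] (fun p : ↥R => (⟨(d p.1.1, d p.1.2), hd _ _ p.2⟩ : ↥R)) := by
    intro d hd
    have hd' : ∀ x y, (x, y) ∈ R → (d x, d y) ∈ R := by
      intro x y hxy
      rw [← h.union] at hxy
      obtain ⟨n, hn⟩ := mem_iUnion.1 hxy
      obtain ⟨m, hm⟩ := hd n
      exact h.sub m (hm _ _ hn)
    refine ⟨hd', h.cont_dom T _ fun n => ?_⟩
    obtain ⟨m, hm⟩ := hd n
    let χ : ↥(Rs n) → ↥(Rs m) := fun p => ⟨(d p.1.1, d p.1.2), hm _ _ p.2⟩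
    have hχ : Continuous χ := by
      refine Continuous.subtype_mk ?_ _
      fun_prop
    have h5 : Continuous[_, T] (h.incl m ∘ χ) :=
      @Continuous.comp _ _ _ _ _ T χ (h.incl m) (h.cont_incl m) hχ
    exact h5
  obtain ⟨hb, hbc⟩ := key b h1
  obtain ⟨hb', hbc'⟩ := key b.symm h2
  refine ⟨b.isHomeomorph, fun x y => ⟨hb x y, fun hxy => by simpa using hb' _ _ hxy⟩,
    (fun p : ↥R => (⟨(b p.1.1, b p.1.2), hb _ _ p.2⟩ : ↥R)), fun p => rfl, ?_⟩
  let _ := T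
  refine isHomeomorph_iff_exists_inverse.2 ⟨hbc,
    (fun p : ↥R => (⟨(b.symm p.1.1, b.symm p.1.2), hb' _ _ p.2⟩ : ↥R)), ?_, ?_, hbc'⟩
  · intro p; simp
  · intro p; simp

theorem et_of [T2Space X] (h : AFD R T Rs) {Y : Set X} (hYc : IsClosed Y)
    (hY : IsEtaleEquivRel (restrictRel R Y) (restrictTop R T Y)) :
    Et (fun n x y => (x, y) ∈ Rs n) Y := by
  intro n
  have hcl : IsClosed (Rs n) := (good_of_ceer (h.ceer n)).closed
  refine isClosed_of_closure_subset fun p hp => ?_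
  have hpn : p ∈ Rs n := hcl.closure_subset_iff.2 (fun q hq => hq.1) hp
  have hp1 : p.1 ∈ Y :=
    (hYc.preimage continuous_fst).closure_subset_iff.2 (fun q hq => hq.2.1) hp
  refine ⟨hpn, hp1, fun hp2 => ?_⟩
  obtain ⟨O, hO, hpO, hinj⟩ := loc_inj (h.ceer n) hpn
  let θ : ↥(restrictRel R Y) → ↥R := fun q => ⟨((q.1.1 : X), (q.1.2 : X)), q.2⟩
  have hθ : Continuous[restrictTop R T Y, T] θ := continuous_induced_dom
  have hV : IsOpen[restrictTop R T Y] (θ ⁻¹' {q : ↥R | (q : X × X) ∈ Rs n ∩ O}) :=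
    (@continuous_def _ _ (restrictTop R T Y) T θ).1 hθ _ (h.open_val n hO)
  have hr := @IsLocalHomeomorph.isOpenMap _ _ (restrictTop R T Y) _ _ hY.localHomeo_range _ hV
  obtain ⟨O2, hO2, hO2e⟩ := isOpen_induced_iff.1 hr
  have hmem : ∀ x : Y, (x : X) ∈ O2 → ∃ y : Y, ((x : X), (y : X)) ∈ Rs n ∩ O := by
    intro x hx
    have : x ∈ Subtype.val ⁻¹' O2 := hx
    rw [hO2e] at this
    obtain ⟨q, hq, rfl⟩ := this
    exact ⟨q.1.2, hq⟩
  have hp1O : p.1 ∈ O2 := by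
    have : (⟨p.1, hp1⟩ : Y) ∈ Subtype.val ⁻¹' O2 := by
      rw [hO2e]
      exact ⟨⟨(⟨p.1, hp1⟩, ⟨p.2, hp2⟩), h.sub n hpn⟩, ⟨hpn, hpO⟩, rfl⟩
    exact this
  obtain ⟨q, ⟨hqO, hqO2⟩, hqn, hq1, hq2⟩ := mem_closure_iff.1 hp
    (O ∩ Prod.fst ⁻¹' O2) (hO.inter (hO2.preimage continuous_fst)) ⟨hpO, hp1O⟩
  obtain ⟨y, hy⟩ := hmem ⟨q.1, hq1⟩ hqO2
  have := hinj q (q.1, y) hqn hy.1 hqO hy.2 rfl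
  apply hq2
  rw [this]
  exact y.2

theorem inv_of [CompactSpace X] [T2Space X] [MeasurableSpace X] (h : AFD R T Rs) {μ : Measure X}
    (hμ : InvAbs (fun n x y => (x, y) ∈ Rs n) μ) : IsInvariantMeasure R T μ := by
  classical
  rintro U ⟨hU, hA, hB, hr, hs⟩
  let _ := T
  haveI : CompactSpace U := by
    refine ⟨hr.isCompact_iff.2 ?_⟩
    convert hA.isClosed.isCompact using 1
    ext x
    simp
  obtain ⟨n, hn⟩ := h.cpt_bound (Subtype.val : U → ↥R) continuous_subtype_val
  let φ : X → X := fun x => if hx : ∃ p ∈ U, (p : X × X).1 = x then (hx.choose : X × X).2 else x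
  have hφ : ∀ p ∈ U, φ (p : X × X).1 = (p : X × X).2 := by
    intro p hp
    have hx : ∃ q ∈ U, (q : X × X).1 = (p : X × X).1 := ⟨p, hp, rfl⟩
    have h1 : φ (p : X × X).1 = (hx.choose : X × X).2 := dif_pos hx
    have h2 : (⟨hx.choose, hx.choose_spec.1⟩ : U) = ⟨p, hp⟩ :=
      hr.injective hx.choose_spec.2
    rw [h1, show hx.choose = p from congrArg Subtype.val h2]
  refine hμ n _ _ φ hA hB ⟨?_, ?_, ?_⟩ ?_
  · rintro _ ⟨p, hp, rfl⟩
    exact ⟨p, hp, (hφ p hp).symm⟩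
  · rintro _ ⟨p, hp, rfl⟩ _ ⟨q, hq, rfl⟩ hpq
    simp only [hφ p hp, hφ q hq] at hpq
    have h2 : (⟨p, hp⟩ : U) = ⟨q, hq⟩ := hs.injective hpq
    rw [show p = q from congrArg Subtype.val h2]
  · rintro _ ⟨p, hp, rfl⟩
    exact ⟨_, ⟨p, hp, rfl⟩, hφ p hp⟩
  · rintro _ ⟨p, hp, rfl⟩
    change ((p : X × X).1, φ (p : X × X).1) ∈ Rs n
    rw [hφ p hp]
    exact hn ⟨p, hp⟩

theorem small_of [CompactSpace X] [T2Space X] [SecondCountableTopology X]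
    [TotallyDisconnectedSpace X] (h : AFD R T Rs) (hmin : IsMinimalRel R) {Y : Set X}
    (hYc : IsClosed Y) (hY : @IsThin X _ (borel X) R T Y) :
    Small (fun n x y => (x, y) ∈ Rs n) (Subtype.val : Y → X) := by
  letI : MeasurableSpace X := borel X
  haveI : BorelSpace X := ⟨rfl⟩
  refine small_of_thin h.sys ?_ hYc fun μ hμ hinv => hY μ hμ (inv_of h hinv)
  intro A hA hAne x
  obtain ⟨y, hyA, hy⟩ := (hmin x).inter_open_nonempty A hA.isOpen hAne
  have hy' : (x, y) ∈ R := hy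
  rw [← h.union] at hy'
  obtain ⟨n, hn⟩ := mem_iUnion.1 hy'
  exact ⟨n, y, hyA, hn⟩

end Translate

theorem final {X₁ X₂ : Type} [TopologicalSpace X₁] [TopologicalSpace X₂]
    [CompactSpace X₁] [CompactSpace X₂]
    [TopologicalSpace.MetrizableSpace X₁] [TopologicalSpace.MetrizableSpace X₂]
    [TotallyDisconnectedSpace X₁] [TotallyDisconnectedSpace X₂]
    (R₁ : Set (X₁ × X₁)) (T₁ : TopologicalSpace ↥R₁)
    (R₂ : Set (X₂ × X₂)) (T₂ : TopologicalSpace ↥R₂)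
    (hAF₁ : IsAFEquivRel R₁ T₁) (hAF₂ : IsAFEquivRel R₂ T₂)
    (hmin₁ : IsMinimalRel R₁) (hmin₂ : IsMinimalRel R₂)
    (Y₁ : Set X₁) (Y₂ : Set X₂) (hY₁c : IsClosed Y₁) (hY₂c : IsClosed Y₂)
    (hY₁e : IsEtaleEquivRel (restrictRel R₁ Y₁) (restrictTop R₁ T₁ Y₁))
    (hY₂e : IsEtaleEquivRel (restrictRel R₂ Y₂) (restrictTop R₂ T₂ Y₂))
    (hY₁t : @IsThin X₁ _ (borel X₁) R₁ T₁ Y₁)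
    (hY₂t : @IsThin X₂ _ (borel X₂) R₂ T₂ Y₂)
    (hiso : ∃ F : X₁ → X₂, ImplementsIso R₁ T₁ R₂ T₂ F)
    (α : ↥Y₁ → ↥Y₂)
    (hα : ImplementsIso (restrictRel R₁ Y₁) (restrictTop R₁ T₁ Y₁)
      (restrictRel R₂ Y₂) (restrictTop R₂ T₂ Y₂) α) :
    ∃ β : X₁ → X₂, ImplementsIso R₁ T₁ R₂ T₂ β ∧ ∀ y : ↥Y₁, β (y : X₁) = (α y : X₂) := by
  have : SecondCountableTopology X₁ := by
    let _ := TopologicalSpace.metrizableSpaceMetric X₁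
    infer_instance
  have : SecondCountableTopology X₂ := by
    let _ := TopologicalSpace.metrizableSpaceMetric X₂
    infer_instance
  obtain ⟨Rs, h₁⟩ := afd_of hAF₁
  obtain ⟨Rs', h₂⟩ := afd_of hAF₂
  obtain ⟨F, hF⟩ := hiso
  have hF' := iso_symm hF
  have hα' := iso_symm hα
  let f : X₁ ≃ₜ X₂ := hF.1.homeomorph
  have hfF : ∀ x, f x = F x := fun x => rfl
  have bF := iso_bound h₁ h₂ hF
  have bF' : ∀ n, ∃ m, ∀ x y, (x, y) ∈ Rs' n → (f.symm x, f.symm y) ∈ Rs m :=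
    iso_bound h₂ h₁ hF'
  have hcl₁ : ∀ n, IsClosed (Rs n) := fun n => (good_of_ceer (h₁.ceer n)).closed
  have hcl₂ : ∀ n, IsClosed (Rs' n) := fun n => (good_of_ceer (h₂.ceer n)).closed
  have bα := iso_bound_restrict h₁ h₂ hY₁c.isCompact hcl₁ hα
  have bα' := iso_bound_restrict h₂ h₁ hY₂c.isCompact hcl₂ hα'
  have hαs : ∀ w, hα.1.homeomorph.symm (α w) = w := fun w =>
    hα.1.homeomorph.symm_apply_apply w
  have : CompactSpace Y₁ := isCompact_iff_compactSpace.1 hY₁c.isCompact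
  let c : Y₁ → X₁ := fun w => f.symm (α w)
  have hrc : ∀ x, x ∈ range c ↔ f x ∈ Y₂ := by
    intro x
    constructor
    · rintro ⟨w, rfl⟩; simp [c]
    · intro hx
      obtain ⟨w, hw⟩ := hα.1.surjective ⟨f x, hx⟩
      exact ⟨w, by simp [c, hw]⟩
  obtain ⟨b, hb1, hb2, hb3⟩ := main_abstract (W := Y₁) (R := fun n x y => (x, y) ∈ Rs n)
    (a := Subtype.val) (c := c) h₁.sys
    (fun x y hxy => by
      have : (x, y) ∈ Rs 0 := hxy
      rw [h₁.zero] at this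
      exact this)
    continuous_subtype_val
    (f.symm.continuous.comp (continuous_subtype_val.comp hα.1.continuous))
    Subtype.val_injective
    (f.symm.injective.comp (Subtype.val_injective.comp hα.1.injective))
    (by
      intro n
      obtain ⟨m, hm⟩ := bα n
      obtain ⟨l, hl⟩ := bF' m
      exact ⟨l, fun w w' h => hl _ _ (hm _ _ h)⟩)
    (by
      intro n
      obtain ⟨m, hm⟩ := bF n
      obtain ⟨l, hl⟩ := bα' m
      refine ⟨l, fun w w' h => ?_⟩
      have h1 := hm _ _ h
      simp only [← hfF, c, Homeomorph.apply_symm_apply] at h1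
      have h2 := hl _ _ h1
      rwa [hαs, hαs] at h2)
    (by rw [Subtype.range_val]; exact et_of h₁ hY₁c hY₁e)
    (by
      intro n
      obtain ⟨m, hm⟩ := bF n
      have h1 : Continuous fun p : X₁ × X₁ => (f p.1, f p.2) := by fun_prop
      have h2 := (hcl₁ n).inter ((et_of h₂ hY₂c hY₂e m).preimage h1)
      convert h2 using 1
      ext ⟨x, y⟩
      simp only [mem_inter_iff, mem_ofPred_eq, mem_preimage, hrc]
      constructor
      · rintro ⟨h3, h4⟩
        exact ⟨h3, hm _ _ h3, h4⟩
      · rintro ⟨h3, -, h4⟩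
        exact ⟨h3, h4⟩)
    (small_of h₁ hmin₁ hY₁c hY₁t)
    (by
      intro A hA hAne
      obtain ⟨n, φ, hφ, hφi, hφA, hφR⟩ := small_of h₂ hmin₂ hY₂c hY₂t (f.symm ⁻¹' A)
        (hA.preimage f.symm.continuous) (hAne.preimage f.symm.surjective)
      obtain ⟨m, hm⟩ := bF' n
      exact ⟨m, fun w => f.symm (φ (α w)), f.symm.continuous.comp (hφ.comp hα.1.continuous),
        f.symm.injective.comp (hφi.comp hα.1.injective), fun w => hφA _,
        fun w => hm _ _ (hφR _)⟩)
  refine ⟨F ∘ b, iso_trans (implements_of h₁ b hb2 hb3) hF, fun w => ?_⟩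
  rw [Function.comp, hb1, ← hfF]
  simp [c]

end Gluing

/-- **gluing theorem, Lemma 4.15 of GPS2.** Let `(R₁, T₁)`, `(R₂, T₂)` be
minimal AF-equivalence relations on Cantor sets `X₁`, `X₂`, and let `Yᵢ ⊆ Xᵢ` be closed,
`Rᵢ`-étale and `Rᵢ`-thin. If `R₁ ≅ R₂` and a homeomorphism `α : Y₁ → Y₂` implements an
isomorphism between the restrictions, then `α` extends to a homeomorphism `ᾱ : X₁ → X₂`
implementing an isomorphism between `R₁` and `R₂`. -/
theorem gluing_extension {X₁ X₂ : Type} [TopologicalSpace X₁] [TopologicalSpace X₂]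
    [CompactSpace X₁] [CompactSpace X₂]
    [TopologicalSpace.MetrizableSpace X₁] [TopologicalSpace.MetrizableSpace X₂]
    [TotallyDisconnectedSpace X₁] [TotallyDisconnectedSpace X₂]
    [Nonempty X₁] [Nonempty X₂]
    (hperf₁ : ∀ x : X₁, Filter.NeBot (nhdsWithin x {x}ᶜ))
    (hperf₂ : ∀ x : X₂, Filter.NeBot (nhdsWithin x {x}ᶜ))
    (R₁ : Set (X₁ × X₁)) (T₁ : TopologicalSpace ↥R₁)
    (R₂ : Set (X₂ × X₂)) (T₂ : TopologicalSpace ↥R₂)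
    (hAF₁ : IsAFEquivRel R₁ T₁) (hAF₂ : IsAFEquivRel R₂ T₂)
    (hmin₁ : IsMinimalRel R₁) (hmin₂ : IsMinimalRel R₂)
    (Y₁ : Set X₁) (Y₂ : Set X₂) (hY₁c : IsClosed Y₁) (hY₂c : IsClosed Y₂)
    (hY₁e : IsEtaleEquivRel (restrictRel R₁ Y₁) (restrictTop R₁ T₁ Y₁))
    (hY₂e : IsEtaleEquivRel (restrictRel R₂ Y₂) (restrictTop R₂ T₂ Y₂))
    (hY₁t : @IsThin X₁ _ (borel X₁) R₁ T₁ Y₁)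
    (hY₂t : @IsThin X₂ _ (borel X₂) R₂ T₂ Y₂)
    (hiso : ∃ F : X₁ → X₂, ImplementsIso R₁ T₁ R₂ T₂ F)
    (α : ↥Y₁ → ↥Y₂)
    (hα : ImplementsIso (restrictRel R₁ Y₁) (restrictTop R₁ T₁ Y₁)
      (restrictRel R₂ Y₂) (restrictTop R₂ T₂ Y₂) α) :
    ∃ β : X₁ → X₂, ImplementsIso R₁ T₁ R₂ T₂ β ∧
      ∀ y : ↥Y₁, β (y : X₁) = ((α y : ↥Y₂) : X₂) := by
  exact Gluing.final R₁ T₁ R₂ T₂ hAF₁ hAF₂ hmin₁ hmin₂ Y₁ Y₂ hY₁c hY₂c hY₁e hY₂e hY₁t hY₂t hiso α hα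
end

section
/- Let (R,T) be a minimal AF-equivalence relation on the Cantor set X, and let {a_n}_{n≥1} and {b_n}_{n≥1} be sequences of natural numbers. Then there exists a simple Bratteli diagram (V,E) such that R ≅ AF(V,E) and, for each n ≥ 1: (i) #(V_n) ≥ a_n; (ii) for all v ∈ V_{n-1} and all w ∈ V_n, the number of edges e ∈ E_n with i(e) = v and t(e) = w is at least b_n. -/
open Set Topology MeasureTheory

universe u v

/-! ### Proof of the theorem -/

namespace Rooms

/-- The equivalence class of `x`. -/
def cls {X : Type u} (R : Set (X × X)) (x : X) : Set X := {y | (x, y) ∈ R}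

/-- The properties of a CEER which are used in the construction. -/
structure Good {X : Type u} [MetricSpace X] (R : Set (X × X)) : Prop where
  refl : ∀ x : X, (x, x) ∈ R
  symm : ∀ ⦃x y : X⦄, (x, y) ∈ R → (y, x) ∈ R
  trans : ∀ ⦃x y z : X⦄, (x, y) ∈ R → (y, z) ∈ R → (x, z) ∈ R
  closed : ∀ K : Set X, IsClosed K → IsClosed {x | ∃ y ∈ K, (x, y) ∈ R}
  isOpen : ∀ U : Set X, IsOpen U → IsOpen {x | ∃ y ∈ U, (x, y) ∈ R}
  sep : ∃ δ > 0, ∀ x y : X, (x, y) ∈ R → dist x y < δ → x = y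

theorem Good.cls_eq {X : Type u} [MetricSpace X] {R : Set (X × X)} (h : Good R) {x y : X}
    (hxy : (x, y) ∈ R) : cls R x = cls R y := by
  ext z
  exact ⟨fun hz => h.trans (h.symm hxy) hz, fun hz => h.trans hxy hz⟩

theorem good_of_ceer {X : Type u} [MetricSpace X] (R : Set (X × X))
    (hR : IsCEER R (relTop R)) : Good R := by
  have hloc : IsLocalHomeomorph (fun p : ↥R => (p : X × X).1) := hR.1.localHomeo_range
  haveI hcpt : CompactSpace ↥R := hR.2
  have hc1 : Continuous (fun p : ↥R => (p : X × X).1) := by fun_prop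
  have hc2 : Continuous (fun p : ↥R => (p : X × X).2) := by fun_prop
  refine ⟨hR.1.refl, hR.1.symm, hR.1.trans, ?_, ?_, ?_⟩
  · intro K hK
    have h1 : IsClosed ((fun p : ↥R => (p : X × X).2) ⁻¹' K) := hK.preimage hc2
    have h2 := (h1.isCompact.image hc1).isClosed
    convert h2 using 1
    ext x
    constructor
    · rintro ⟨y, hy, hxy⟩
      exact ⟨⟨(x, y), hxy⟩, hy, rfl⟩
    · rintro ⟨⟨⟨x', y⟩, hxy⟩, hy, rfl⟩
      exact ⟨y, hy, hxy⟩
  · intro U hU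
    have h1 : IsOpen ((fun p : ↥R => (p : X × X).2) ⁻¹' U) := hU.preimage hc2
    have h2 := hloc.isOpenMap _ h1
    convert h2 using 1
    ext x
    constructor
    · rintro ⟨y, hy, hxy⟩
      exact ⟨⟨(x, y), hxy⟩, hy, rfl⟩
    · rintro ⟨⟨⟨x', y⟩, hxy⟩, hy, rfl⟩
      exact ⟨y, hy, hxy⟩
  · have hop : IsOpen {p : ↥R | (p : X × X).1 = (p : X × X).2} := by
      rw [isOpen_iff_mem_nhds]
      rintro p hp
      obtain ⟨e, hpe, he⟩ := hloc p
      let d : ↥R → ↥R := fun q => ⟨((q : X × X).1, (q : X × X).1), hR.1.refl _⟩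
      have hd : Continuous d := by
        apply Continuous.subtype_mk
        fun_prop
      have hdp : d p = p := Subtype.ext (Prod.ext rfl hp)
      have hW : e.source ∈ 𝓝 p := e.open_source.mem_nhds hpe
      have hW' : d ⁻¹' e.source ∈ 𝓝 p := hd.continuousAt.preimage_mem_nhds (by rw [hdp]; exact hW)
      filter_upwards [hW, hW'] with q hq hq'
      have : d q = q := by
        apply e.injOn hq' hq
        rw [← he]
      have h3 := congrArg (fun r : ↥R => (r : X × X).2) this
      exact h3
    have hK : IsCompact {p : ↥R | (p : X × X).1 = (p : X × X).2}ᶜ := hop.isClosed_compl.isCompact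
    obtain ⟨δ, hδ, h⟩ := hK.exists_forall_le' (f := fun p : ↥R => dist (p : X × X).1 (p : X × X).2)
      (by fun_prop) (a := 0) (fun p hp => dist_pos.2 hp)
    refine ⟨δ, hδ, fun x y hxy hlt => ?_⟩
    by_contra hne
    exact absurd (h ⟨(x, y), hxy⟩ hne) (not_le.2 hlt)

/-- The tower of `x`. -/
def tow {X : Type u} (R : Set (X × X)) (f : X → ℕ) (x : X) : Set ℕ := f '' cls R x

theorem tow_locConst {X : Type u} [MetricSpace X] [CompactSpace X] {R : Set (X × X)}
    (hR : Good R) {f : X → ℕ} (hf : IsLocallyConstant f) : IsLocallyConstant (tow R f) := by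
  rw [IsLocallyConstant.iff_eventually_eq]
  intro x
  have key : ∀ i ∈ Set.range f, ∀ᶠ y in 𝓝 x, (i ∈ tow R f y ↔ i ∈ tow R f x) := by
    intro i _
    have hset : {x | ∃ y ∈ f ⁻¹' {i}, (x, y) ∈ R} = {x | i ∈ tow R f x} := by
      ext z
      constructor
      · rintro ⟨y, hy, hzy⟩
        exact ⟨y, hzy, hy⟩
      · rintro ⟨y, hzy, hy⟩
        exact ⟨y, hy, hzy⟩
    have ho := hR.isOpen _ (hf.isOpen_fiber i)
    have hc := hR.closed _ (hf.isClosed_fiber i)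
    change IsOpen {x | ∃ y ∈ f ⁻¹' {i}, (x, y) ∈ R} at ho
    change IsClosed {x | ∃ y ∈ f ⁻¹' {i}, (x, y) ∈ R} at hc
    rw [hset] at ho hc
    by_cases hx : i ∈ tow R f x
    · filter_upwards [ho.mem_nhds hx] with y hy
      exact ⟨fun _ => hx, fun _ => hy⟩
    · filter_upwards [hc.isOpen_compl.mem_nhds hx] with y hy
      exact ⟨fun h => absurd h hy, fun h => absurd h hx⟩
  have := (hf.range_finite.eventually_all).2 key
  filter_upwards [this] with y hy
  ext i
  by_cases hi : i ∈ Set.range f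
  · exact hy i hi
  · constructor
    · rintro ⟨z, _, rfl⟩
      exact absurd ⟨z, rfl⟩ hi
    · rintro ⟨z, _, rfl⟩
      exact absurd ⟨z, rfl⟩ hi

theorem exists_code {X : Type u} {S : Type v} [TopologicalSpace X] [CompactSpace X] {h : X → S}
    (hh : IsLocallyConstant h) :
    ∃ g : X → ℕ, IsLocallyConstant g ∧ ∀ x y, g x = g y ↔ h x = h y := by
  haveI : Finite (Set.range h) := hh.range_finite
  obtain ⟨c, hc⟩ := exists_injective_nat (Set.range h)
  refine ⟨fun x => c ⟨h x, x, rfl⟩, ?_, fun x y => ?_⟩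
  · rw [IsLocallyConstant.iff_eventually_eq] at hh ⊢
    intro x
    filter_upwards [hh x] with y hy
    simp only [hy]
  · exact hc.eq_iff.trans Subtype.ext_iff

theorem exists_mesh {X : Type u} [MetricSpace X] [CompactSpace X] [TotallyDisconnectedSpace X]
    {ε : ℝ} (hε : 0 < ε) :
    ∃ g : X → ℕ, IsLocallyConstant g ∧ ∀ x y, g x = g y → dist x y < ε := by
  have h1 : ∀ x : X, ∃ V : Set X, IsClopen V ∧ x ∈ V ∧ V ⊆ Metric.ball x (ε / 2) := fun x =>
    compact_exists_isClopen_in_isOpen Metric.isOpen_ball (Metric.mem_ball_self (by positivity))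
  choose V hV hxV hVb using h1
  obtain ⟨t, ht⟩ := isCompact_univ.elim_finite_subcover V (fun x => (hV x).isOpen)
    (fun x _ => Set.mem_iUnion.2 ⟨x, hxV x⟩)
  have hloc : IsLocallyConstant (fun x => {i | i ∈ t ∧ x ∈ V i}) := by
    rw [IsLocallyConstant.iff_eventually_eq]
    intro x
    have key : ∀ i ∈ t, ∀ᶠ y in 𝓝 x, (y ∈ V i ↔ x ∈ V i) := by
      intro i _
      by_cases hx : x ∈ V i
      · filter_upwards [(hV i).isOpen.mem_nhds hx] with y hy
        exact ⟨fun _ => hx, fun _ => hy⟩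
      · filter_upwards [(hV i).isClosed.isOpen_compl.mem_nhds hx] with y hy
        exact ⟨fun h => absurd h hy, fun h => absurd h hx⟩
    filter_upwards [(Filter.eventually_all_finset t).2 key] with y hy
    ext i
    exact and_congr_right fun hi => hy i hi
  obtain ⟨g, hg, hgh⟩ := exists_code hloc
  refine ⟨g, hg, fun x y hxy => ?_⟩
  have h2 := (hgh x y).1 hxy
  obtain ⟨i, hi, hxi⟩ := Set.mem_iUnion₂.1 (ht (Set.mem_univ x))
  have h3 : i ∈ {i | i ∈ t ∧ y ∈ V i} := by
    rw [← h2]; exact ⟨hi, hxi⟩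
  have h4 := hVb i hxi
  have h5 := hVb i h3.2
  rw [Metric.mem_ball] at h4 h5
  have := dist_triangle_right x y i
  linarith

theorem finite_sep {X : Type u} [MetricSpace X] {K : Set X} (hK : K.Finite) :
    ∃ ε > 0, ∀ x ∈ K, ∀ y ∈ K, dist x y < ε → x = y := by
  have h1 : IsCompact (K.offDiag) := hK.offDiag.isCompact
  obtain ⟨δ, hδ, h⟩ := h1.exists_forall_le' (f := fun p : X × X => dist p.1 p.2)
      (by fun_prop) (a := 0) (fun p hp => dist_pos.2 hp.2.2)
  refine ⟨δ, hδ, fun x hx y hy hlt => ?_⟩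
  by_contra hne
  exact absurd (h (x, y) ⟨hx, hy, hne⟩) (not_le.2 hlt)

/-- Every class of some `Rs k` meets a given nonempty open set. -/
theorem exists_meets {X : Type u} [MetricSpace X] [CompactSpace X] {Rs : ℕ → Set (X × X)}
    (hmono : Monotone Rs) (hgood : ∀ n, Good (Rs n)) (hmin : IsMinimalRel (⋃ n, Rs n))
    {U : Set X} (hU : IsOpen U) (hne : U.Nonempty) :
    ∃ k, ∀ m, k ≤ m → ∀ x, ∃ y ∈ U, (x, y) ∈ Rs m := by
  obtain ⟨k, hk⟩ := isCompact_univ.elim_directed_cover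
    (fun n => {x | ∃ y ∈ U, (x, y) ∈ Rs n}) (fun n => (hgood n).isOpen U hU)
    (by
      intro x _
      obtain ⟨y, hyU, hy⟩ := (hmin x).inter_open_nonempty U hU hne
      obtain ⟨n, hn⟩ := Set.mem_iUnion.1 hy
      exact Set.mem_iUnion.2 ⟨n, y, hyU, hn⟩)
    (directed_of_isDirected_le (fun i j hij x ⟨y, hy, h⟩ => ⟨y, hy, hmono hij h⟩))
  refine ⟨k, fun m hm x => ?_⟩
  obtain ⟨y, hy, h⟩ := hk (Set.mem_univ x)
  exact ⟨y, hy, hmono hm h⟩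

/-- State invariant: `f` is locally constant and injective on the classes of `R`. -/
structure Inv {X : Type u} [TopologicalSpace X] (R : Set (X × X)) (f : X → ℕ) : Prop where
  loc : IsLocallyConstant f
  inj : ∀ x y, (x, y) ∈ R → f x = f y → x = y

/-- Step relation. -/
structure Step {X : Type u} [MetricSpace X] (R R' : Set (X × X)) (f f' : X → ℕ) (n a b : ℕ) :
    Prop where
  refine : ∀ x y, f' x = f' y → f x = f y
  det : ∀ x y, f' x = f' y → tow R f' x = tow R f' y
  mesh : ∀ x y, f' x = f' y → dist x y < 1 / ((n : ℝ) + 1)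
  many : ∃ p : Fin a → X, Function.Injective fun i => tow R' f' (p i)
  edges : ∀ x z, ∃ y : Fin b → X, (∀ i, (x, y i) ∈ R') ∧ (∀ i, tow R f (y i) = tow R f z) ∧
    ∀ i j, (y i, y j) ∈ R → i = j

theorem exists_edges {X : Type u} [MetricSpace X] [CompactSpace X]
    (hperf : ∀ x : X, Filter.NeBot (nhdsWithin x {x}ᶜ)) {Rs : ℕ → Set (X × X)}
    (hmono : Monotone Rs) (hgood : ∀ n, Good (Rs n)) (hmin : IsMinimalRel (⋃ n, Rs n))
    {R : Set (X × X)} (hR : Good R) {f : X → ℕ} (hf : Inv R f) (b : ℕ) :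
    ∃ k, ∀ m, k ≤ m → ∀ x z, ∃ y : Fin b → X, (∀ i, (x, y i) ∈ Rs m) ∧
      (∀ i, tow R f (y i) = tow R f z) ∧ ∀ i j, (y i, y j) ∈ R → i = j := by
  have hT := tow_locConst hR hf.loc
  have hpair : IsLocallyConstant (fun x => (f x, tow R f x)) := hf.loc.prodMk hT
  have hfin := hpair.range_finite
  have key : ∀ q ∈ Set.range (fun x => (f x, tow R f x)), ∃ k, ∀ m, k ≤ m → ∀ x,
      ∃ y : Fin b → X, (∀ i, (x, y i) ∈ Rs m) ∧
      (∀ i, tow R f (y i) = q.2) ∧ ∀ i j, (y i, y j) ∈ R → i = j := by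
    rintro _ ⟨z, rfl⟩
    set A : Set X := {x | (f x, tow R f x) = (f z, tow R f z)} with hA
    have hAo : IsOpen A := hpair.isOpen_fiber _
    have hAz : z ∈ A := rfl
    haveI := hperf z
    have hAinf : A.Infinite := infinite_of_mem_nhds z (hAo.mem_nhds hAz)
    obtain ⟨K, hKA, hKc⟩ := hAinf.exists_subset_card_eq b
    obtain ⟨ε, hε, hsep⟩ := finite_sep K.finite_toSet
    let p : Fin b ≃ K := (Fintype.equivFinOfCardEq (by simp [hKc])).symm
    have h1 : ∀ i : Fin b, ∃ k, ∀ m, k ≤ m → ∀ x,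
        ∃ y ∈ A ∩ Metric.ball (p i : X) (ε / 2), (x, y) ∈ Rs m := fun i =>
      exists_meets hmono hgood hmin (hAo.inter Metric.isOpen_ball)
        ⟨p i, hKA (p i).2, Metric.mem_ball_self (by positivity)⟩
    choose k hk using h1
    refine ⟨Finset.univ.sup k, fun m hm x => ?_⟩
    have h2 : ∀ i : Fin b, ∃ y ∈ A ∩ Metric.ball (p i : X) (ε / 2), (x, y) ∈ Rs m := fun i =>
      hk i m ((Finset.le_sup (Finset.mem_univ i)).trans hm) x
    choose y hy hxy using h2
    refine ⟨y, hxy, fun i => (Prod.ext_iff.1 (hy i).1).2, fun i j hij => ?_⟩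
    have hfi : f (y i) = f z := (Prod.ext_iff.1 (hy i).1).1
    have hfj : f (y j) = f z := (Prod.ext_iff.1 (hy j).1).1
    have heq : y i = y j := hf.inj _ _ hij (hfi.trans hfj.symm)
    have d1 := (hy i).2
    have d2 := (hy j).2
    rw [Metric.mem_ball] at d1 d2
    rw [heq] at d1
    have d3 := dist_triangle_left (p i : X) (p j : X) (y j)
    have := hsep _ (p i).2 _ (p j).2 (by linarith)
    exact p.injective (Subtype.ext this)
  choose! k hk using key
  refine ⟨hfin.toFinset.sup k, fun m hm x z => ?_⟩
  exact hk _ ⟨z, rfl⟩ m ((Finset.le_sup (hfin.mem_toFinset.2 ⟨z, rfl⟩)).trans hm) x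

theorem exists_labels {X : Type u} [MetricSpace X] [CompactSpace X] [TotallyDisconnectedSpace X]
    [Infinite X] {R R' : Set (X × X)} (hR : Good R) (hR' : Good R')
    {f : X → ℕ} (hf : Inv R f) (n a : ℕ) :
    ∃ f' : X → ℕ, Inv R' f' ∧ (∀ x y, f' x = f' y → f x = f y) ∧
      (∀ x y, f' x = f' y → tow R f' x = tow R f' y) ∧
      (∀ x y, f' x = f' y → dist x y < 1 / ((n : ℝ) + 1)) ∧
      ∃ p : Fin a → X, Function.Injective fun i => tow R' f' (p i) := by
  obtain ⟨δ, hδ, hsep⟩ := hR'.sep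
  have hcf : ∀ x, (cls R' x).Finite := by
    intro x
    obtain ⟨g, hg, hgd⟩ := exists_mesh (X := X) hδ
    have : Set.InjOn g (cls R' x) := fun y hy z hz hyz =>
      hsep y z (hR'.trans (hR'.symm hy) hz) (hgd _ _ hyz)
    exact Set.Finite.of_finite_image (hg.range_finite.subset (Set.image_subset_range _ _)) this
  let s : Setoid X := ⟨fun x y => (x, y) ∈ R', hR'.refl, fun h => hR'.symm h,
    fun h h' => hR'.trans h h'⟩
  haveI hqinf : Infinite (Quotient s) := by
    by_contra hfin
    rw [not_infinite_iff_finite] at hfin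
    have : (Set.univ : Set X).Finite := by
      refine (Set.finite_iUnion (fun q : Quotient s => hcf q.out)).subset (fun x _ => ?_)
      exact Set.mem_iUnion.2 ⟨Quotient.mk s x, Quotient.mk_out (s := s) x⟩
    exact Set.infinite_univ this
  let q : Fin a → Quotient s := fun i => Infinite.natEmbedding (Quotient s) i
  have hq : Function.Injective q := fun i j h =>
    Fin.ext ((Infinite.natEmbedding (Quotient s)).injective h)
  let p : Fin a → X := fun i => (q i).out
  have hp : ∀ i j, (p i, p j) ∈ R' → i = j := fun i j h => hq (Quotient.out_equiv_out.1 h)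
  obtain ⟨ε, hε, hKsep⟩ := finite_sep (Set.finite_iUnion (fun i => hcf (p i)))
  have hn : (0 : ℝ) < 1 / ((n : ℝ) + 1) := by positivity
  obtain ⟨c, hc, hcd⟩ := exists_mesh (X := X) (lt_min (lt_min hδ hε) hn)
  obtain ⟨g, hg, hgk⟩ := exists_code (hf.loc.prodMk hc)
  obtain ⟨h, hh, hhk⟩ := exists_code (hg.prodMk (tow_locConst hR hg))
  have hg1 : ∀ x y, h x = h y → g x = g y := fun x y e => (Prod.ext_iff.1 ((hhk x y).1 e)).1
  have hg2 : ∀ x y, h x = h y → f x = f y := fun x y e =>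
    (Prod.ext_iff.1 ((hgk x y).1 (hg1 x y e))).1
  have hg3 : ∀ x y, h x = h y → dist x y < min (min δ ε) (1 / ((n : ℝ) + 1)) := fun x y e =>
    hcd _ _ (Prod.ext_iff.1 ((hgk x y).1 (hg1 x y e))).2
  have hdet : ∀ x y, h x = h y → tow R h x ⊆ tow R h y := by
    rintro x y e _ ⟨z, hz, rfl⟩
    have e2 : tow R g x = tow R g y := (Prod.ext_iff.1 ((hhk x y).1 e)).2
    have : g z ∈ tow R g y := by rw [← e2]; exact ⟨z, hz, rfl⟩
    obtain ⟨z', hz', hzz⟩ := this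
    refine ⟨z', hz', (hhk _ _).2 (Prod.ext hzz ?_)⟩
    change g '' _ = g '' _
    rw [← hR.cls_eq hz, ← hR.cls_eq hz']
    exact e2.symm
  refine ⟨h, ⟨hh, fun x y hxy e => hsep x y hxy ?_⟩, hg2, fun x y e => (hdet x y e).antisymm
    (hdet y x e.symm), fun x y e => (hg3 x y e).trans_le (min_le_right _ _), p, ?_⟩
  · exact (hg3 x y e).trans_le ((min_le_left _ _).trans (min_le_left _ _))
  · intro i j hij
    have : h (p i) ∈ tow R' h (p j) := by
      have e : tow R' h (p i) = tow R' h (p j) := hij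
      rw [← e]; exact ⟨p i, hR'.refl _, rfl⟩
    obtain ⟨z, hz, hzz⟩ := this
    have := hKsep z (Set.mem_iUnion.2 ⟨j, hz⟩) (p i) (Set.mem_iUnion.2 ⟨i, hR'.refl _⟩)
      ((hg3 _ _ hzz).trans_le ((min_le_left _ _).trans (min_le_right _ _)))
    subst this
    exact (hp j i hz).symm

/-- The data from which the diagram is built. -/
structure RoomData (X : Type) [MetricSpace X] (a b : ℕ → ℕ) where
  S : ℕ → Set (X × X)
  f : ℕ → X → ℕ
  good : ∀ n, Good (S n)
  mono : ∀ n, S n ⊆ S (n + 1)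
  inv : ∀ n, Inv (S n) (f n)
  step : ∀ n, Step (S n) (S (n + 1)) (f n) (f (n + 1)) n (a n) (b n)
  S0 : S 0 = Set.diagonal X
  f0 : ∀ x, f 0 x = 0

theorem exists_roomData {X : Type} [MetricSpace X] [CompactSpace X] [TotallyDisconnectedSpace X]
    [Nonempty X]
    (hperf : ∀ x : X, Filter.NeBot (nhdsWithin x {x}ᶜ)) {Rs : ℕ → Set (X × X)}
    (hmono : Monotone Rs) (hgood : ∀ n, Good (Rs n)) (hmin : IsMinimalRel (⋃ n, Rs n))
    (h0 : Rs 0 = Set.diagonal X) (a b : ℕ → ℕ) :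
    ∃ (D : RoomData X a b) (k : ℕ → ℕ), StrictMono k ∧ ∀ n, D.S n = Rs (k n) := by
  haveI : Infinite X := by
    obtain ⟨x⟩ := ‹Nonempty X›
    haveI := hperf x
    exact Set.infinite_univ_iff.1 (infinite_of_mem_nhds x Filter.univ_mem)
  have hstep : ∀ (n : ℕ) (s : {s : ℕ × (X → ℕ) // Inv (Rs s.1) s.2}),
      ∃ s' : {s : ℕ × (X → ℕ) // Inv (Rs s.1) s.2}, s.1.1 < s'.1.1 ∧
        Step (Rs s.1.1) (Rs s'.1.1) s.1.2 s'.1.2 n (a n) (b n) := by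
    rintro n ⟨⟨k, f⟩, hf⟩
    obtain ⟨k', hk'⟩ := exists_edges hperf hmono hgood hmin (hgood k) hf (b n)
    obtain ⟨f', h1, h2, h3, h4, h5⟩ :=
      exists_labels (hgood k) (hgood (max k' (k + 1))) hf n (a n)
    exact ⟨⟨(max k' (k + 1), f'), h1⟩, lt_of_lt_of_le (Nat.lt_succ_self k) (le_max_right _ _),
      ⟨h2, h3, h4, h5, hk' _ (le_max_left _ _)⟩⟩
  choose nxt hlt hst using hstep
  have hinv0 : Inv (Rs 0) (fun _ : X => 0) := by
    refine ⟨IsLocallyConstant.const 0, fun x y hxy _ => ?_⟩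
    rw [h0] at hxy
    exact hxy
  let st : ℕ → {s : ℕ × (X → ℕ) // Inv (Rs s.1) s.2} := fun n =>
    Nat.rec ⟨(0, fun _ => 0), hinv0⟩ (fun n s => nxt n s) n
  have hk : StrictMono fun n => (st n).1.1 := strictMono_nat_of_lt_succ fun n => hlt n (st n)
  exact ⟨{ S := fun n => Rs (st n).1.1
           f := fun n => (st n).1.2
           good := fun n => hgood _
           mono := fun n => hmono (hlt n (st n)).le
           inv := fun n => (st n).2
           step := fun n => hst n (st n)
           S0 := h0
           f0 := fun _ => rfl }, fun n => (st n).1.1, hk, fun _ => rfl⟩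

namespace RoomData

variable {X : Type} [MetricSpace X] {a b : ℕ → ℕ} (D : RoomData X a b)

/-- The vertex of `x` at level `n`. -/
def vtx (n : ℕ) (x : X) : Set ℕ := tow (D.S n) (D.f n) x

/-- The edge of `x` at level `n`. -/
def edg (n : ℕ) (x : X) : Set ℕ × Set ℕ :=
  (tow (D.S n) (D.f (n + 1)) x, tow (D.S (n + 1)) (D.f (n + 1)) x)

theorem vtx_of_rel {n : ℕ} {x y : X} (h : (x, y) ∈ D.S n) : D.vtx n x = D.vtx n y := by
  unfold vtx tow
  rw [(D.good n).cls_eq h]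

theorem edg_of_rel {n : ℕ} {x y : X} (h : (x, y) ∈ D.S n) : D.edg n x = D.edg n y := by
  unfold edg tow
  rw [(D.good n).cls_eq h, (D.good (n + 1)).cls_eq (D.mono n h)]

theorem vtx_sub_of_edg {n : ℕ} {x y : X} (h : D.edg n x = D.edg n y) :
    D.vtx n x ⊆ D.vtx n y := by
  rintro _ ⟨z, hz, rfl⟩
  have h1 : tow (D.S n) (D.f (n + 1)) x = tow (D.S n) (D.f (n + 1)) y := (Prod.ext_iff.1 h).1
  have h2 : D.f (n + 1) z ∈ tow (D.S n) (D.f (n + 1)) y := by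
    rw [← h1]; exact ⟨z, hz, rfl⟩
  obtain ⟨z', hz', e⟩ := h2
  exact ⟨z', hz', (D.step n).refine _ _ e⟩

theorem vtx_of_edg {n : ℕ} {x y : X} (h : D.edg n x = D.edg n y) : D.vtx n x = D.vtx n y :=
  (D.vtx_sub_of_edg h).antisymm (D.vtx_sub_of_edg h.symm)

theorem vtx_succ_of_edg {n : ℕ} {x y : X} (h : D.edg n x = D.edg n y) :
    D.vtx (n + 1) x = D.vtx (n + 1) y := (Prod.ext_iff.1 h).2

/-- The label and vertex at level `n + 1` determine the edge at level `n`. -/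
theorem edg_of_label {n : ℕ} {x y : X} (hf : D.f (n + 1) x = D.f (n + 1) y)
    (hv : D.vtx (n + 1) x = D.vtx (n + 1) y) : D.edg n x = D.edg n y :=
  Prod.ext ((D.step n).det _ _ hf) hv

theorem edg_lt_of_label {n : ℕ} : ∀ {x y : X}, D.f n x = D.f n y →
    D.vtx n x = D.vtx n y → ∀ m < n, D.edg m x = D.edg m y := by
  induction n with
  | zero => intro x y _ _ m hm; exact absurd hm (Nat.not_lt_zero _)
  | succ n ih =>
    intro x y hf hv m hm
    have he := D.edg_of_label hf hv
    rcases Nat.lt_succ_iff_lt_or_eq.1 hm with h | rfl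
    · exact ih ((D.step n).refine _ _ hf) (D.vtx_of_edg he) m h
    · exact he

theorem label_of_edg {n : ℕ} {x y : X} (h : ∀ m < n, D.edg m x = D.edg m y) :
    D.f n x = D.f n y := by
  induction n with
  | zero => rw [D.f0, D.f0]
  | succ n ih =>
    have h0 := ih fun m hm => h m (hm.trans (Nat.lt_succ_self n))
    have h1 : tow (D.S n) (D.f (n + 1)) x = tow (D.S n) (D.f (n + 1)) y :=
      (Prod.ext_iff.1 (h n (Nat.lt_succ_self n))).1
    have h2 : D.f (n + 1) x ∈ tow (D.S n) (D.f (n + 1)) y := by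
      rw [← h1]; exact ⟨x, (D.good n).refl x, rfl⟩
    obtain ⟨z, hz, e⟩ := h2
    have h3 : D.f n z = D.f n y := ((D.step n).refine _ _ e).trans h0
    have h4 : y = z := (D.inv n).inj y z hz h3.symm
    rw [← e, h4]

theorem eq_of_edg {x y : X} (h : ∀ m, D.edg m x = D.edg m y) : x = y := by
  by_contra hne
  obtain ⟨n, hn⟩ := exists_nat_one_div_lt (dist_pos.2 hne)
  exact absurd ((D.step n).mesh x y (D.label_of_edg fun m _ => h m)) (not_lt.2 hn.le)

/-- Adjust `y` within its class so that it has the label of `x`. -/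
theorem exists_adjust {n : ℕ} {x y : X} (h : D.vtx n x = D.vtx n y) :
    ∃ y', (y, y') ∈ D.S n ∧ D.f n y' = D.f n x ∧ D.vtx n y' = D.vtx n x := by
  have : D.f n x ∈ D.vtx n y := by
    rw [← h]; exact ⟨x, (D.good n).refl x, rfl⟩
  obtain ⟨y', hy', e⟩ := this
  exact ⟨y', hy', e, (D.vtx_of_rel hy').symm.trans h.symm⟩

theorem mono_le {n m : ℕ} (h : n ≤ m) : D.S n ⊆ D.S m := monotone_nat_of_le_succ D.mono h

theorem rel_iff {n : ℕ} {x y : X} : (x, y) ∈ D.S n ↔ ∀ m, n ≤ m → D.edg m x = D.edg m y := by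
  constructor
  · intro h m hm
    exact D.edg_of_rel (D.mono_le hm h)
  · intro h
    obtain ⟨y', h1, h2, h3⟩ := D.exists_adjust (D.vtx_of_edg (h n le_rfl))
    have : y' = x := by
      apply D.eq_of_edg
      intro m
      rcases lt_or_ge m n with hm | hm
      · exact D.edg_lt_of_label h2 h3 m hm
      · rw [h m hm]
        exact (D.edg_of_rel (D.mono_le hm h1)).symm
    subst this
    exact (D.good n).symm h1

theorem vtx_zero (x : X) : D.vtx 0 x = {0} := by
  unfold vtx tow
  ext i
  constructor
  · rintro ⟨z, _, rfl⟩
    exact D.f0 z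
  · rintro rfl
    exact ⟨x, (D.good 0).refl x, D.f0 x⟩

variable [CompactSpace X]

theorem vtx_locConst (n : ℕ) : IsLocallyConstant (D.vtx n) :=
  tow_locConst (D.good n) (D.inv n).loc

theorem edg_locConst (n : ℕ) : IsLocallyConstant (D.edg n) :=
  (tow_locConst (D.good n) (D.inv (n + 1)).loc).prodMk
    (tow_locConst (D.good (n + 1)) (D.inv (n + 1)).loc)

/-- The Bratteli diagram of the data. -/
def diagram [Nonempty X] : BratteliDiagram where
  V n := Set.range (D.vtx n)
  E n := Set.range (D.edg n)
  fin_V n := (D.vtx_locConst n).range_finite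
  fin_E n := (D.edg_locConst n).range_finite
  nonempty_V n := inferInstance
  nonempty_E n := inferInstance
  subsingleton_V0 := by
    constructor
    rintro ⟨_, x, rfl⟩ ⟨_, y, rfl⟩
    simp only [D.vtx_zero]
  src n e := ⟨D.vtx n e.2.choose, _, rfl⟩
  rng n e := ⟨D.vtx (n + 1) e.2.choose, _, rfl⟩
  src_surj n := by
    rintro ⟨_, x, rfl⟩
    refine ⟨⟨D.edg n x, x, rfl⟩, Subtype.ext (D.vtx_of_edg ?_)⟩
    exact Exists.choose_spec (p := fun y => D.edg n y = D.edg n x) _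
  rng_surj n := by
    rintro ⟨_, x, rfl⟩
    refine ⟨⟨D.edg n x, x, rfl⟩, Subtype.ext (D.vtx_succ_of_edg ?_)⟩
    exact Exists.choose_spec (p := fun y => D.edg n y = D.edg n x) _

variable [Nonempty X]

/-- The vertex of `x` in the diagram. -/
def toV (n : ℕ) (x : X) : D.diagram.V n := ⟨D.vtx n x, x, rfl⟩

/-- The edge of `x` in the diagram. -/
def toE (n : ℕ) (x : X) : D.diagram.E n := ⟨D.edg n x, x, rfl⟩

theorem toV_eq {n : ℕ} {x y : X} : D.toV n x = D.toV n y ↔ D.vtx n x = D.vtx n y :=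
  Subtype.ext_iff

theorem toE_eq {n : ℕ} {x y : X} : D.toE n x = D.toE n y ↔ D.edg n x = D.edg n y :=
  Subtype.ext_iff

theorem toV_surj (n : ℕ) : Function.Surjective (D.toV n) := by
  rintro ⟨_, x, rfl⟩
  exact ⟨x, rfl⟩

theorem toE_surj (n : ℕ) : Function.Surjective (D.toE n) := by
  rintro ⟨_, x, rfl⟩
  exact ⟨x, rfl⟩

theorem src_toE (n : ℕ) (x : X) : D.diagram.src n (D.toE n x) = D.toV n x := by
  refine Subtype.ext (D.vtx_of_edg ?_)
  exact Exists.choose_spec (p := fun y => D.edg n y = D.edg n x) _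

theorem rng_toE (n : ℕ) (x : X) : D.diagram.rng n (D.toE n x) = D.toV (n + 1) x := by
  refine Subtype.ext (D.vtx_succ_of_edg ?_)
  exact Exists.choose_spec (p := fun y => D.edg n y = D.edg n x) _

theorem card_V (n : ℕ) : a n ≤ Nat.card (D.diagram.V (n + 1)) := by
  obtain ⟨p, hp⟩ := (D.step n).many
  haveI := D.diagram.fin_V (n + 1)
  have := Nat.card_le_card_of_injective (fun i => D.toV (n + 1) (p i))
    (fun i j h => hp (D.toV_eq.1 h))
  simpa using this

theorem card_E (n : ℕ) (v : D.diagram.V n) (w : D.diagram.V (n + 1)) :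
    b n ≤ Nat.card {e : D.diagram.E n // D.diagram.src n e = v ∧ D.diagram.rng n e = w} := by
  obtain ⟨z, rfl⟩ := D.toV_surj n v
  obtain ⟨x, rfl⟩ := D.toV_surj (n + 1) w
  obtain ⟨y, h1, h2, h3⟩ := (D.step n).edges x z
  haveI := D.diagram.fin_E n
  have := Nat.card_le_card_of_injective
    (fun i => (⟨D.toE n (y i), (D.src_toE n (y i)).trans (D.toV_eq.2 (h2 i)),
      (D.rng_toE n (y i)).trans (D.toV_eq.2 (D.vtx_of_rel (h1 i)).symm)⟩ :
      {e : D.diagram.E n // D.diagram.src n e = D.toV n z ∧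
        D.diagram.rng n e = D.toV (n + 1) x}))
    (by
      intro i j hij
      have e0 : D.edg n (y i) = D.edg n (y j) := D.toE_eq.1 (Subtype.ext_iff.1 hij)
      have e1 : tow (D.S n) (D.f (n + 1)) (y i) = tow (D.S n) (D.f (n + 1)) (y j) :=
        (Prod.ext_iff.1 e0).1
      have e2 : D.f (n + 1) (y i) ∈ tow (D.S n) (D.f (n + 1)) (y j) := by
        rw [← e1]; exact ⟨y i, (D.good n).refl _, rfl⟩
      obtain ⟨t, ht, e⟩ := e2
      have hG := D.good (n + 1)
      have : t = y i := (D.inv (n + 1)).inj _ _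
        (hG.trans (hG.symm (D.mono n ht)) (hG.trans (hG.symm (h1 j)) (h1 i))) e
      subst this
      exact (h3 j i ht).symm)
  simpa using this

/-- The path of `x`. -/
def path (x : X) : D.diagram.pathSpace :=
  ⟨fun n => D.toE n x, fun n => (D.rng_toE n x).trans (D.src_toE (n + 1) x).symm⟩

theorem path_inj : Function.Injective D.path := fun x y h =>
  D.eq_of_edg fun m => D.toE_eq.1 (congrFun (Subtype.ext_iff.1 h) m)

theorem path_cont : @Continuous _ _ _ D.diagram.pathTop D.path := by
  letI : ∀ n, TopologicalSpace (D.diagram.E n) := fun _ => ⊥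
  change Continuous D.path
  apply Continuous.subtype_mk
  refine continuous_pi fun n => IsLocallyConstant.continuous ?_
  have h := D.edg_locConst n
  rw [IsLocallyConstant.iff_eventually_eq] at h ⊢
  intro x
  filter_upwards [h x] with y hy
  exact D.toE_eq.2 hy

theorem exists_prefix (p : D.diagram.pathSpace) (n : ℕ) :
    ∃ x, ∀ m ≤ n, D.toE m x = p.1 m := by
  induction n with
  | zero =>
    obtain ⟨x, hx⟩ := D.toE_surj 0 (p.1 0)
    refine ⟨x, fun m hm => ?_⟩
    obtain rfl := Nat.le_zero.1 hm
    exact hx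
  | succ n ih =>
    obtain ⟨x, hx⟩ := ih
    obtain ⟨z, hz⟩ := D.toE_surj (n + 1) (p.1 (n + 1))
    have hv : D.vtx (n + 1) x = D.vtx (n + 1) z := by
      rw [← D.toV_eq, ← D.rng_toE, ← D.src_toE, hz, hx n le_rfl]
      exact p.2 n
    obtain ⟨y, h1, h2, h3⟩ := D.exists_adjust hv
    refine ⟨y, fun m hm => ?_⟩
    rcases Nat.lt_or_eq_of_le hm with h | rfl
    · rw [← hx m (Nat.lt_succ_iff.1 h), D.toE_eq]
      exact D.edg_lt_of_label h2 h3 m h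
    · rw [← hz, D.toE_eq]
      exact (D.edg_of_rel h1).symm

theorem path_surj : Function.Surjective D.path := by
  intro p
  have hcl : ∀ n, IsClosed {x | ∀ m ≤ n, D.toE m x = p.1 m} := by
    intro n
    have : {x | ∀ m ≤ n, D.toE m x = p.1 m} = ⋂ m, ⋂ (_ : m ≤ n), {x | D.edg m x = (p.1 m).1} := by
      ext x
      simp only [Set.mem_setOf_eq, Set.mem_iInter]
      exact forall_congr' fun m => forall_congr' fun _ => Subtype.ext_iff
    rw [this]
    exact isClosed_iInter fun m => isClosed_iInter fun _ => (D.edg_locConst m).isClosed_fiber _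
  obtain ⟨x, hx⟩ := IsCompact.nonempty_iInter_of_sequence_nonempty_isCompact_isClosed
    (fun n => {x | ∀ m ≤ n, D.toE m x = p.1 m})
    (fun n x hx m hm => hx m (hm.trans (Nat.le_succ n))) (fun n => D.exists_prefix p n)
    (hcl 0).isCompact hcl
  refine ⟨x, Subtype.ext (funext fun n => ?_)⟩
  exact Set.mem_iInter.1 hx n n le_rfl

theorem path_homeo : @IsHomeomorph _ _ _ D.diagram.pathTop D.path := by
  letI : ∀ n, TopologicalSpace (D.diagram.E n) := fun _ => ⊥
  haveI : ∀ n, DiscreteTopology (D.diagram.E n) := fun _ => ⟨rfl⟩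
  have hc : Continuous D.path := D.path_cont
  change IsHomeomorph D.path
  exact isHomeomorph_iff_continuous_bijective.2 ⟨hc, D.path_inj, D.path_surj⟩

theorem rel_iff_path {n : ℕ} {x y : X} :
    (x, y) ∈ D.S n ↔ (D.path x, D.path y) ∈ D.diagram.AFn n := by
  rw [D.rel_iff]
  exact forall_congr' fun m => forall_congr' fun _ => D.toE_eq.symm

theorem simple (hb : ∀ n, 1 ≤ b n) : D.diagram.IsSimple := by
  intro n
  refine ⟨0, fun v w => ?_⟩
  have h1 := (hb n).trans (D.card_E n v w)
  obtain ⟨⟨e, he1, he2⟩⟩ := (Nat.card_pos_iff.1 h1).1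
  classical
  let x : X := Classical.arbitrary X
  refine ⟨Function.update (fun j => D.toE j x) n e, ?_, ?_, ?_⟩
  · rw [Function.update_self]; exact he1
  · change D.diagram.rng n (Function.update (fun j => D.toE j x) n e n) = w
    rw [Function.update_self]; exact he2
  · intro j h1 h2
    omega

end RoomData

/-- Continuity of maps between inductive limits. -/
theorem indlim_cont {A : Type u} {B : Type v} [TopologicalSpace A] [TopologicalSpace B]
    (R : Set A) (Rn : ℕ → Set A) (hR : ∀ n, Rn n ⊆ R) (Q : Set B) (Qn : ℕ → Set B)
    (hQ : ∀ n, Qn n ⊆ Q) (φ : A → B) (hφ : Continuous φ) (g : ↥R → ↥Q)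
    (hg : ∀ p, (g p : B) = φ p) (h : ∀ n, ∃ m, ∀ p ∈ Rn n, φ p ∈ Qn m) :
    @Continuous _ _
      (⨆ n, TopologicalSpace.coinduced (fun p : ↥(Rn n) => (⟨(p : A), hR n p.2⟩ : ↥R))
        inferInstance)
      (⨆ n, TopologicalSpace.coinduced (fun p : ↥(Qn n) => (⟨(p : B), hQ n p.2⟩ : ↥Q))
        inferInstance) g := by
  rw [continuous_iSup_dom]
  intro n
  rw [continuous_coinduced_dom]
  obtain ⟨m, hm⟩ := h n
  apply continuous_iSup_rng (i := m)
  have hc : Continuous (fun p : ↥(Rn n) => (⟨φ p, hm p p.2⟩ : ↥(Qn m))) := by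
    apply Continuous.subtype_mk
    exact hφ.comp continuous_subtype_val
  have heq : (g ∘ fun p : ↥(Rn n) => (⟨(p : A), hR n p.2⟩ : ↥R)) =
      (fun p : ↥(Qn m) => (⟨(p : B), hQ m p.2⟩ : ↥Q)) ∘
        (fun p : ↥(Rn n) => (⟨φ p, hm p p.2⟩ : ↥(Qn m))) := by
    funext p
    exact Subtype.ext (hg _)
  rw [heq]
  exact @Continuous.comp _ _ _ _ _ (_) _ _ continuous_coinduced_rng hc

end Rooms

/-- A minimal AF-equivalence relation `(R, T)` on the Cantor set
admits, for any prescribed sequences `{aₙ}`, `{bₙ}` of natural numbers (indexed by the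
levels `n ≥ 1`, here `a n` and `b n` prescribe level `n + 1` data), a simple Bratteli
diagram model `(V,E)` with `#(Vₙ) ≥ aₙ` and at least `bₙ` edges between any vertex of
`V_{n-1}` and any vertex of `Vₙ`. -/
theorem enough_rooms {X : Type} [TopologicalSpace X] [CompactSpace X]
    [TopologicalSpace.MetrizableSpace X] [TotallyDisconnectedSpace X] [Nonempty X]
    (hperf : ∀ x : X, Filter.NeBot (nhdsWithin x {x}ᶜ))
    (R : Set (X × X)) (T : TopologicalSpace ↥R)
    (hAF : IsAFEquivRel R T) (hmin : IsMinimalRel R)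
    (a b : ℕ → ℕ) :
    ∃ B : BratteliDiagram, B.IsSimple ∧
      (letI := B.pathTop;
        ∃ F : X → B.pathSpace, ImplementsIso R T B.AF B.AFTop F) ∧
      (∀ n : ℕ, a n ≤ Nat.card (B.V (n + 1))) ∧
      (∀ (n : ℕ) (v : B.V n) (w : B.V (n + 1)),
        b n ≤ Nat.card {e : B.E n // B.src n e = v ∧ B.rng n e = w}) := by
  obtain ⟨Rs, hsub, h0, hsucc, hceer, _, hUn, hT⟩ := hAF
  letI : MetricSpace X := TopologicalSpace.metrizableSpaceMetric X
  have hgood : ∀ n, Rooms.Good (Rs n) := fun n => Rooms.good_of_ceer _ (hceer n)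
  have hmono : Monotone Rs := monotone_nat_of_le_succ hsucc
  obtain ⟨D, k, hk, hS⟩ := Rooms.exists_roomData hperf hmono hgood (by rw [hUn]; exact hmin) h0 a
    (fun n => b n + 1)
  refine ⟨D.diagram, D.simple (fun n => Nat.le_add_left 1 _), ?_, D.card_V,
    fun n v w => (Nat.le_succ _).trans (D.card_E n v w)⟩
  letI := D.diagram.pathTop
  have hF : IsHomeomorph D.path := D.path_homeo
  have hRn : ∀ n, ∀ p ∈ Rs n, (D.path p.1, D.path p.2) ∈ D.diagram.AFn n := by
    rintro n ⟨x, y⟩ hp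
    rw [← D.rel_iff_path, hS]
    exact hmono (hk.id_le n) hp
  have hRm : ∀ n x y, (D.path x, D.path y) ∈ D.diagram.AFn n → (x, y) ∈ Rs (k n) := by
    intro n x y h
    rw [← D.rel_iff_path, hS] at h
    exact h
  have hrel : ∀ x y : X, (x, y) ∈ R ↔ (D.path x, D.path y) ∈ D.diagram.AF := by
    intro x y
    rw [← hUn]
    constructor
    · intro h
      obtain ⟨n, hn⟩ := Set.mem_iUnion.1 h
      exact Set.mem_iUnion.2 ⟨n, hRn n _ hn⟩
    · intro h
      obtain ⟨n, hn⟩ := Set.mem_iUnion.1 h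
      exact Set.mem_iUnion.2 ⟨k n, hRm n x y hn⟩
  let H : X ≃ₜ D.diagram.pathSpace := hF.homeomorph
  have hHp : ∀ x, H x = D.path x := fun _ => rfl
  have hHs : ∀ q, D.path (H.symm q) = q := fun q => H.apply_symm_apply q
  let G : ↥R ≃ ↥D.diagram.AF :=
    { toFun := fun p => ⟨(D.path p.1.1, D.path p.1.2), (hrel _ _).1 p.2⟩
      invFun := fun q => ⟨(H.symm q.1.1, H.symm q.1.2), (hrel _ _).2 (by
        rw [hHs, hHs]; exact q.2)⟩
      left_inv := fun p => Subtype.ext (Prod.ext (H.symm_apply_apply _) (H.symm_apply_apply _))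
      right_inv := fun q => Subtype.ext (Prod.ext (hHs _) (hHs _)) }
  refine ⟨D.path, hF, hrel, G, fun p => rfl, ?_⟩
  subst hT
  have hsubAF : ∀ n, D.diagram.AFn n ⊆ D.diagram.AF := fun n => Set.subset_iUnion _ n
  have hG1 : @Continuous _ _ (inductiveLimitTop R Rs hsub) D.diagram.AFTop G :=
    Rooms.indlim_cont R Rs hsub D.diagram.AF D.diagram.AFn hsubAF
      (fun p => (D.path p.1, D.path p.2)) (by
        have := hF.continuous
        fun_prop) G (fun _ => rfl) (fun n => ⟨n, hRn n⟩)
  have hG2 : @Continuous _ _ D.diagram.AFTop (inductiveLimitTop R Rs hsub) G.symm :=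
    Rooms.indlim_cont D.diagram.AF D.diagram.AFn hsubAF R Rs hsub
      (fun p => (H.symm p.1, H.symm p.2)) (by
        have := H.symm.continuous
        fun_prop) G.symm (fun _ => rfl) (fun n => ⟨k n, fun p hp => hRm n _ _ (by
          rw [hHs, hHs]; exact hp)⟩)
  letI := inductiveLimitTop R Rs hsub
  letI := D.diagram.AFTop
  let GH : ↥R ≃ₜ ↥D.diagram.AF :=
    { G with
      continuous_toFun := hG1
      continuous_invFun := hG2 }
  exact GH.isHomeomorph
end
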